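/- arXiv:math/0002060 — 3 statements merged into one kernel-verified Lean document; each statement's English description precedes it below -/
import Mathlib

section
/- For any orientation Γ⁰ of the graph Γ, the zigzag algebra A(Γ) is isomorphic as a ℂ-algebra to the trivial extension algebra T(B) = B ⊕ B* of B = B^red(Γ⁰), where B* = Hom_ℂ(B, ℂ) carries the B-bimodule structure (x·f·y)(z) = f(yzx) and T(B) has multiplication (x, f)(y, g) = (xy, xg + fy). -/
/-!
The zigzag algebra `A(Γ)` of a finite simple graph `Γ`, presented as a quotient of the
free algebra on generators `{e_a : a ∈ V} ∪ {x_{ab} : a,b adjacent}`.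
-/

noncomputable section

/-- Generators of the zigzag algebra: one idempotent `e_a` per vertex `a`, and one
generator `x_{ab}` (the arrow `a → b` in the double quiver) per ordered adjacent pair. -/
def ZigzagGen {V : Type} (G : SimpleGraph V) : Type :=
  V ⊕ {p : V × V // G.Adj p.1 p.2}

/-- The idempotent generator `e_a` inside the free algebra. -/
def zge (k : Type) [CommRing k] {V : Type} (G : SimpleGraph V) (a : V) :
    FreeAlgebra k (ZigzagGen G) :=
  FreeAlgebra.ι k (Sum.inl a)

/-- The arrow generator `x_{ab}` inside the free algebra. -/
def zgx (k : Type) [CommRing k] {V : Type} (G : SimpleGraph V) {a b : V} (h : G.Adj a b) :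
    FreeAlgebra k (ZigzagGen G) :=
  FreeAlgebra.ι k (Sum.inr ⟨(a, b), h⟩)

/-- The defining relations of the zigzag algebra `A(Γ)`:
`e_a e_b = δ_{ab} e_a`, `Σ_a e_a = 1`, `e_b x_{ab} = x_{ab} = x_{ab} e_a`,
`x_{bc} x_{ab} = 0` for `c ≠ a`, and `x_{ba} x_{ab} = x_{ca} x_{ac}`. -/
inductive ZigzagRel (k : Type) [CommRing k] {V : Type} [Fintype V] (G : SimpleGraph V) :
    FreeAlgebra k (ZigzagGen G) → FreeAlgebra k (ZigzagGen G) → Prop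
  | idem (a : V) : ZigzagRel k G (zge k G a * zge k G a) (zge k G a)
  | orth (a b : V) (h : a ≠ b) : ZigzagRel k G (zge k G a * zge k G b) 0
  | sum_one : ZigzagRel k G (∑ a : V, zge k G a) 1
  | target_id {a b : V} (h : G.Adj a b) :
      ZigzagRel k G (zge k G b * zgx k G h) (zgx k G h)
  | source_id {a b : V} (h : G.Adj a b) :
      ZigzagRel k G (zgx k G h * zge k G a) (zgx k G h)
  | comp_zero {a b c : V} (h₁ : G.Adj a b) (h₂ : G.Adj b c) (hca : c ≠ a) :
      ZigzagRel k G (zgx k G h₂ * zgx k G h₁) 0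
  | zigzag {a b c : V} (hab : G.Adj a b) (hac : G.Adj a c) :
      ZigzagRel k G (zgx k G hab.symm * zgx k G hab) (zgx k G hac.symm * zgx k G hac)

/-- The zigzag algebra `A(Γ)`. -/
abbrev ZigzagAlgebra (k : Type) [CommRing k] {V : Type} [Fintype V] (G : SimpleGraph V) : Type :=
  RingQuot (ZigzagRel k G)

/-- The idempotent `e_a` of the zigzag algebra. -/
def ZigzagAlgebra.e (k : Type) [CommRing k] {V : Type} [Fintype V] (G : SimpleGraph V)
    (a : V) : ZigzagAlgebra k G :=
  RingQuot.mkAlgHom k (ZigzagRel k G) (zge k G a)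

/-! ### The algebra `B^red(Γ⁰)` of an orientation `Γ⁰` of `Γ` -/

/-- Generators of `B^red(Γ⁰)`: one idempotent per vertex and one generator per arrow of
the orientation `O`. -/
def OrGen {V : Type} (O : V → V → Prop) : Type :=
  V ⊕ {p : V × V // O p.1 p.2}

/-- The defining relations of `B^red(Γ⁰)` (the path algebra of `Γ⁰` modulo paths of
length `≥ 2`): the `e_a` are orthogonal idempotents summing to `1`, an arrow `f : a → b`
satisfies `e_b f = f = f e_a`, and the product of any two arrows is zero. -/
inductive OrRel (k : Type) [CommRing k] {V : Type} [Fintype V] (O : V → V → Prop) :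
    FreeAlgebra k (OrGen O) → FreeAlgebra k (OrGen O) → Prop
  | idem (a : V) :
      OrRel k O (FreeAlgebra.ι k (Sum.inl a : OrGen O) * FreeAlgebra.ι k (Sum.inl a))
        (FreeAlgebra.ι k (Sum.inl a))
  | orth (a b : V) (h : a ≠ b) :
      OrRel k O (FreeAlgebra.ι k (Sum.inl a : OrGen O) * FreeAlgebra.ι k (Sum.inl b)) 0
  | sum_one : OrRel k O (∑ a : V, FreeAlgebra.ι k (Sum.inl a : OrGen O)) 1
  | target_id {a b : V} (h : O a b) :
      OrRel k O (FreeAlgebra.ι k (Sum.inl b : OrGen O) * FreeAlgebra.ι k (Sum.inr ⟨(a, b), h⟩))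
        (FreeAlgebra.ι k (Sum.inr ⟨(a, b), h⟩))
  | source_id {a b : V} (h : O a b) :
      OrRel k O (FreeAlgebra.ι k (Sum.inr ⟨(a, b), h⟩ : OrGen O) * FreeAlgebra.ι k (Sum.inl a))
        (FreeAlgebra.ι k (Sum.inr ⟨(a, b), h⟩))
  | arrows_zero (p q : {p : V × V // O p.1 p.2}) :
      OrRel k O (FreeAlgebra.ι k (Sum.inr p : OrGen O) * FreeAlgebra.ι k (Sum.inr q)) 0

/-- The algebra `B^red(Γ⁰)`: the path algebra of the orientation `Γ⁰`, modulo the ideal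
of all paths of length at least two. -/
abbrev PathAlgebraRed (k : Type) [CommRing k] {V : Type} [Fintype V]
    (O : V → V → Prop) : Type :=
  RingQuot (OrRel k O)

/-! ### The bimodule structure on `B* = Hom_ℂ(B, ℂ)` and the trivial extension `T(B)` -/

section DualBimodule

variable (B : Type) [Ring B] [Algebra ℂ B]

/-- The left `B`-action on `B* = Hom_ℂ(B, ℂ)`: `(x • f) z = f (z x)`. -/
instance dualModuleLeft : Module B (Module.Dual ℂ B) where
  smul x f := f ∘ₗ LinearMap.mulRight ℂ x
  one_smul f := LinearMap.ext fun z => show f (z * 1) = f z by rw [mul_one]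
  mul_smul x y f := LinearMap.ext fun z =>
    show f (z * (x * y)) = f (z * x * y) by rw [mul_assoc]
  smul_zero x := LinearMap.ext fun z => rfl
  smul_add x f g := LinearMap.ext fun z => rfl
  add_smul x y f := LinearMap.ext fun z =>
    show f (z * (x + y)) = f (z * x) + f (z * y) by rw [mul_add, map_add]
  zero_smul f := LinearMap.ext fun z =>
    show f (z * 0) = 0 by rw [mul_zero, map_zero]

/-- The right `B`-action on `B* = Hom_ℂ(B, ℂ)` (as a left `Bᵐᵒᵖ`-action):
`(f • y) z = f (y z)`. -/
instance dualModuleRight : Module Bᵐᵒᵖ (Module.Dual ℂ B) where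
  smul m f := f ∘ₗ LinearMap.mulLeft ℂ m.unop
  one_smul f := LinearMap.ext fun z => show f (1 * z) = f z by rw [one_mul]
  mul_smul m n f := LinearMap.ext fun z =>
    show f (n.unop * m.unop * z) = f (n.unop * (m.unop * z)) by rw [mul_assoc]
  smul_zero m := LinearMap.ext fun z => rfl
  smul_add m f g := LinearMap.ext fun z => rfl
  add_smul m n f := LinearMap.ext fun z =>
    show f ((m.unop + n.unop) * z) = f (m.unop * z) + f (n.unop * z) by
      rw [add_mul, map_add]
  zero_smul f := LinearMap.ext fun z =>
    show f (0 * z) = 0 by rw [zero_mul, map_zero]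

instance dualSMulCommClass : SMulCommClass B Bᵐᵒᵖ (Module.Dual ℂ B) where
  smul_comm x m f := LinearMap.ext fun z =>
    show f (m.unop * (z * x)) = f (m.unop * z * x) by rw [mul_assoc]

instance dualIsScalarTowerLeft : IsScalarTower ℂ B (Module.Dual ℂ B) where
  smul_assoc c x f := LinearMap.ext fun z =>
    show f (z * (c • x)) = c • f (z * x) by rw [mul_smul_comm, map_smul]

instance dualIsScalarTowerRight : IsScalarTower ℂ Bᵐᵒᵖ (Module.Dual ℂ B) where
  smul_assoc c m f := LinearMap.ext fun z =>
    show f ((c • m).unop * z) = c • f (m.unop * z) by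
      rw [MulOpposite.unop_smul, smul_mul_assoc, map_smul]

end DualBimodule

section ThirdVertex

/-- In a connected graph with more than two vertices, no edge is isolated. -/
theorem SimpleGraph.Connected.exists_adj_ne {V : Type*} [Fintype V] {G : SimpleGraph V}
    (hconn : G.Connected) (hcard : 2 < Fintype.card V) (a c : V) :
    (∃ b, G.Adj a b ∧ b ≠ c) ∨ ∃ d, G.Adj c d ∧ d ≠ a := by
  classical
  by_contra! h
  have hreach : ∀ v, v = a ∨ v = c := fun v => by
    obtain ⟨p⟩ := hconn.preconnected v a
    induction p with
    | nil => exact Or.inl rfl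
    | cons hadj _ ih =>
      rcases ih h with rfl | rfl
      · exact Or.inr (h.1 _ hadj.symm)
      · exact Or.inl (h.2 _ hadj.symm)
  have hle : Fintype.card V ≤ ({a, c} : Finset V).card :=
    Finset.card_le_card fun v _ => by simpa using hreach v
  have := Finset.card_le_two (a := a) (b := c)
  omega

/-- In a connected graph with more than two vertices, every vertex has a neighbour. -/
theorem SimpleGraph.Connected.exists_adj_of_two_lt_card {V : Type*} [Fintype V]
    {G : SimpleGraph V} (hconn : G.Connected) (hcard : 2 < Fintype.card V) (a : V) :
    ∃ b, G.Adj a b := by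
  have h := hconn.exists_adj_ne hcard a a
  simp only [or_self] at h
  exact h.imp fun _ => And.left

end ThirdVertex

namespace ZigzagAlgebra

variable (k : Type) [CommRing k] {V : Type} [Fintype V] (G : SimpleGraph V)

open Classical in
/-- The arrow `x_{ab}` of the zigzag algebra, extended by zero to non-adjacent pairs. -/
def x (a b : V) : ZigzagAlgebra k G :=
  if h : G.Adj a b then RingQuot.mkAlgHom k (ZigzagRel k G) (zgx k G h) else 0

open Classical in
/-- The loop at `a`: the common value of all `x_{ba} x_{ab}` with `b` adjacent to `a`. -/
def loop (a : V) : ZigzagAlgebra k G :=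
  if h : ∃ b, G.Adj a b then x k G h.choose a * x k G a h.choose else 0

variable {G}

theorem x_of_adj {a b : V} (h : G.Adj a b) :
    x k G a b = RingQuot.mkAlgHom k (ZigzagRel k G) (zgx k G h) := dif_pos h

theorem x_of_not_adj {a b : V} (h : ¬ G.Adj a b) : x k G a b = 0 := dif_neg h

theorem x_mul_x_eq_loop {a b : V} (h : G.Adj a b) : x k G b a * x k G a b = loop k G a := by
  have hex : ∃ b, G.Adj a b := ⟨b, h⟩
  rw [loop, dif_pos hex, x_of_adj k h, x_of_adj k h.symm, x_of_adj k hex.choose_spec,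
    x_of_adj k hex.choose_spec.symm, ← map_mul, ← map_mul]
  exact RingQuot.mkAlgHom_rel k (ZigzagRel.zigzag h hex.choose_spec)

theorem sum_e : ∑ a, e k G a = 1 := by
  have h := RingQuot.mkAlgHom_rel k (ZigzagRel.sum_one (k := k) (G := G))
  rw [map_sum, map_one] at h
  exact h

variable {k} in
/-- Universal property of the zigzag algebra. -/
theorem exists_algHom {A : Type*} [Semiring A] [Algebra k A] (E : V → A) (X : V → V → A)
    (idem : ∀ a, E a * E a = E a) (orth : ∀ a b, a ≠ b → E a * E b = 0) (sum_one : ∑ a, E a = 1)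
    (target_id : ∀ a b, G.Adj a b → E b * X a b = X a b)
    (source_id : ∀ a b, G.Adj a b → X a b * E a = X a b)
    (comp_zero : ∀ a b c, G.Adj a b → G.Adj b c → c ≠ a → X b c * X a b = 0)
    (zigzag : ∀ a b c, G.Adj a b → G.Adj a c → X b a * X a b = X c a * X a c) :
    ∃ F : ZigzagAlgebra k G →ₐ[k] A,
      (∀ a, F (e k G a) = E a) ∧ ∀ a b, G.Adj a b → F (x k G a b) = X a b := by
  let L : FreeAlgebra k (ZigzagGen G) →ₐ[k] A :=
    FreeAlgebra.lift k (Sum.elim E fun p => X p.1.1 p.1.2 : ZigzagGen G → A)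
  have hE (a : V) : L (zge k G a) = E a := FreeAlgebra.lift_ι_apply _ _
  have hX {a b : V} (h : G.Adj a b) : L (zgx k G h) = X a b := FreeAlgebra.lift_ι_apply _ _
  have hL : ∀ ⦃y z⦄, ZigzagRel k G y z → L y = L z := by
    rintro _ _ (a | ⟨a, b, h⟩ | _ | h | h | ⟨h₁, h₂, hca⟩ | ⟨hab, hac⟩)
    · rw [map_mul, hE, idem]
    · rw [map_mul, hE, hE, orth a b h, map_zero]
    · simp only [map_sum, hE, sum_one, map_one]
    · rw [map_mul, hE, hX, target_id _ _ h]
    · rw [map_mul, hE, hX, source_id _ _ h]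
    · rw [map_mul, hX, hX, comp_zero _ _ _ h₁ h₂ hca, map_zero]
    · rw [map_mul, map_mul, hX, hX, hX, hX, zigzag _ _ _ hab hac]
  refine ⟨RingQuot.liftAlgHom k ⟨L, hL⟩, fun a => ?_, fun a b h => ?_⟩
  · rw [e, RingQuot.liftAlgHom_mkAlgHom_apply, hE]
  · rw [x_of_adj k h, RingQuot.liftAlgHom_mkAlgHom_apply, hX]

variable {k} in
/-- Algebra maps out of the zigzag algebra are determined by their values on idempotents and
arrows. -/
theorem algHom_ext {A : Type*} [Semiring A] [Algebra k A] {F F' : ZigzagAlgebra k G →ₐ[k] A}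
    (he : ∀ a, F (e k G a) = F' (e k G a))
    (hx : ∀ a b, G.Adj a b → F (x k G a b) = F' (x k G a b)) : F = F' := by
  refine RingQuot.ringQuot_ext' _ _ _ (FreeAlgebra.hom_ext (funext ?_))
  rintro (a | ⟨⟨a, b⟩, h⟩)
  · exact he a
  · have := hx a b h
    rwa [x_of_adj k h] at this

variable [DecidableEq V]

theorem e_mul_e (a b : V) : e k G a * e k G b = if a = b then e k G a else 0 := by
  split_ifs with h
  · subst h
    rw [e, ← map_mul]
    exact RingQuot.mkAlgHom_rel k (ZigzagRel.idem a)
  · rw [e, e, ← map_mul, RingQuot.mkAlgHom_rel k (ZigzagRel.orth a b h), map_zero]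

theorem e_mul_x (c a b : V) : e k G c * x k G a b = if c = b then x k G a b else 0 := by
  by_cases h : G.Adj a b
  · have hb : e k G b * x k G a b = x k G a b := by
      rw [x_of_adj k h, e, ← map_mul]
      exact RingQuot.mkAlgHom_rel k (ZigzagRel.target_id h)
    rw [← hb, ← mul_assoc, e_mul_e]
    split_ifs with hc
    · rw [hc]
    · rw [zero_mul]
  · simp [x_of_not_adj k h]

theorem x_mul_e (c a b : V) : x k G a b * e k G c = if a = c then x k G a b else 0 := by
  by_cases h : G.Adj a b
  · have ha : x k G a b * e k G a = x k G a b := by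
      rw [x_of_adj k h, e, ← map_mul]
      exact RingQuot.mkAlgHom_rel k (ZigzagRel.source_id h)
    rw [← ha, mul_assoc, e_mul_e]
    split_ifs <;> simp
  · simp [x_of_not_adj k h]

theorem x_mul_x_of_ne {a b c d : V} (h : ¬ (c = b ∧ d = a)) : x k G c d * x k G a b = 0 := by
  by_cases hc : c = b
  · subst hc
    by_cases h₁ : G.Adj a c
    · by_cases h₂ : G.Adj c d
      · rw [x_of_adj k h₁, x_of_adj k h₂, ← map_mul,
          RingQuot.mkAlgHom_rel k (ZigzagRel.comp_zero h₁ h₂ fun hd => h ⟨rfl, hd⟩), map_zero]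
      · rw [x_of_not_adj k h₂, zero_mul]
    · rw [x_of_not_adj k h₁, mul_zero]
  · have hd : x k G c d * e k G c = x k G c d := by rw [x_mul_e, if_pos rfl]
    rw [← hd, mul_assoc, e_mul_x, if_neg hc, mul_zero]

theorem e_mul_loop (c a : V) : e k G c * loop k G a = if c = a then loop k G a else 0 := by
  by_cases h : ∃ b, G.Adj a b
  · obtain ⟨b, hb⟩ := h
    rw [← x_mul_x_eq_loop k hb, ← mul_assoc, e_mul_x]
    split_ifs <;> simp
  · simp [loop, dif_neg h]

theorem loop_mul_e (c a : V) : loop k G a * e k G c = if a = c then loop k G a else 0 := by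
  by_cases h : ∃ b, G.Adj a b
  · obtain ⟨b, hb⟩ := h
    rw [← x_mul_x_eq_loop k hb, mul_assoc, x_mul_e]
    split_ifs <;> simp
  · simp [loop, dif_neg h]

theorem loop_mul_x (hconn : G.Connected) (hcard : 2 < Fintype.card V) (a b c : V) :
    loop k G a * x k G c b = 0 := by
  by_cases hab : a = b
  · subst hab
    by_cases hca : G.Adj c a
    · rcases hconn.exists_adj_ne hcard a c with ⟨b, hb, hbc⟩ | ⟨d, hd, hda⟩
      · rw [← x_mul_x_eq_loop k hb, mul_assoc, x_mul_x_of_ne k (by tauto), mul_zero]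
      · rw [← x_mul_x_eq_loop k hca.symm, mul_assoc, x_mul_x_eq_loop k hca,
          ← x_mul_x_eq_loop k hd, ← mul_assoc, x_mul_x_of_ne k (by tauto), zero_mul]
    · rw [x_of_not_adj k hca, mul_zero]
  · have : loop k G a * e k G a = loop k G a := by rw [loop_mul_e, if_pos rfl]
    rw [← this, mul_assoc, e_mul_x, if_neg hab, mul_zero]

theorem x_mul_loop (hconn : G.Connected) (hcard : 2 < Fintype.card V) (a b c : V) :
    x k G b c * loop k G a = 0 := by
  by_cases hba : b = a
  · subst hba
    by_cases hbc : G.Adj b c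
    · rw [← x_mul_x_eq_loop k hbc, ← mul_assoc, x_mul_x_eq_loop k hbc.symm,
        loop_mul_x k hconn hcard]
    · rw [x_of_not_adj k hbc, zero_mul]
  · have : e k G a * loop k G a = loop k G a := by rw [e_mul_loop, if_pos rfl]
    rw [← this, ← mul_assoc, x_mul_e, if_neg hba, zero_mul]

theorem loop_mul_loop (hconn : G.Connected) (hcard : 2 < Fintype.card V) (a b : V) :
    loop k G a * loop k G b = 0 := by
  obtain ⟨c, hc⟩ := hconn.exists_adj_of_two_lt_card hcard b
  rw [← x_mul_x_eq_loop k hc, ← mul_assoc, loop_mul_x k hconn hcard, zero_mul]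

end ZigzagAlgebra

namespace PathAlgebraRed

variable (k : Type) [CommRing k] {V : Type} [Fintype V] (O : V → V → Prop)

/-- The idempotent `e_a` of `B^red(Γ⁰)`. -/
def e (a : V) : PathAlgebraRed k O :=
  RingQuot.mkAlgHom k (OrRel k O) (FreeAlgebra.ι k (Sum.inl a : OrGen O))

open Classical in
/-- The arrow `a → b` of `B^red(Γ⁰)`, extended by zero to all pairs of vertices. -/
def f (a b : V) : PathAlgebraRed k O :=
  if h : O a b then
    RingQuot.mkAlgHom k (OrRel k O) (FreeAlgebra.ι k (Sum.inr ⟨(a, b), h⟩ : OrGen O))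
  else 0

variable {O}

theorem f_of_arrow {a b : V} (h : O a b) : f k O a b =
    RingQuot.mkAlgHom k (OrRel k O) (FreeAlgebra.ι k (Sum.inr ⟨(a, b), h⟩ : OrGen O)) :=
  dif_pos h

theorem f_of_not_arrow {a b : V} (h : ¬ O a b) : f k O a b = 0 := dif_neg h

theorem sum_e : ∑ a, e k O a = 1 := by
  have h := RingQuot.mkAlgHom_rel k (OrRel.sum_one (k := k) (O := O))
  rw [map_sum, map_one] at h
  exact h

variable {k} in
/-- Universal property of `B^red(Γ⁰)`. -/
theorem exists_algHom {A : Type*} [Semiring A] [Algebra k A] (E : V → A) (F : V → V → A)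
    (idem : ∀ a, E a * E a = E a) (orth : ∀ a b, a ≠ b → E a * E b = 0) (sum_one : ∑ a, E a = 1)
    (target_id : ∀ a b, O a b → E b * F a b = F a b)
    (source_id : ∀ a b, O a b → F a b * E a = F a b)
    (arrows_zero : ∀ a b c d, O a b → O c d → F a b * F c d = 0) :
    ∃ L : PathAlgebraRed k O →ₐ[k] A,
      (∀ a, L (e k O a) = E a) ∧ ∀ a b, O a b → L (f k O a b) = F a b := by
  let L : FreeAlgebra k (OrGen O) →ₐ[k] A :=
    FreeAlgebra.lift k (Sum.elim E fun p => F p.1.1 p.1.2 : OrGen O → A)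
  have hE (a : V) : L (FreeAlgebra.ι k (Sum.inl a : OrGen O)) = E a :=
    FreeAlgebra.lift_ι_apply _ _
  have hF (p : {p : V × V // O p.1 p.2}) :
      L (FreeAlgebra.ι k (Sum.inr p : OrGen O)) = F p.1.1 p.1.2 := FreeAlgebra.lift_ι_apply _ _
  have hmul {y z : FreeAlgebra k (OrGen O)} {y' z' : A} (hy : L y = y') (hz : L z = z') :
      L (y * z) = y' * z' := by rw [map_mul, hy, hz]
  have hL : ∀ ⦃y z⦄, OrRel k O y z → L y = L z := by
    rintro _ _ (a | ⟨a, b, h⟩ | _ | h | h | ⟨p, q⟩)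
    · exact (hmul (hE a) (hE a)).trans ((idem a).trans (hE a).symm)
    · exact (hmul (hE a) (hE b)).trans ((orth a b h).trans (map_zero L).symm)
    · rw [map_sum, map_one, ← sum_one]
      exact Finset.sum_congr rfl fun a _ => hE a
    · exact (hmul (hE _) (hF _)).trans ((target_id _ _ h).trans (hF ⟨(_, _), h⟩).symm)
    · exact (hmul (hF _) (hE _)).trans ((source_id _ _ h).trans (hF ⟨(_, _), h⟩).symm)
    · exact (hmul (hF p) (hF q)).trans
        ((arrows_zero _ _ _ _ p.2 q.2).trans (map_zero L).symm)
  refine ⟨RingQuot.liftAlgHom k ⟨L, hL⟩, fun a => ?_, fun a b h => ?_⟩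
  · rw [e, RingQuot.liftAlgHom_mkAlgHom_apply, hE]
  · rw [f_of_arrow k h, RingQuot.liftAlgHom_mkAlgHom_apply, hF]

variable {k} in
/-- Algebra maps out of `B^red(Γ⁰)` are determined by their values on idempotents and arrows. -/
theorem algHom_ext {A : Type*} [Semiring A] [Algebra k A] {F F' : PathAlgebraRed k O →ₐ[k] A}
    (he : ∀ a, F (e k O a) = F' (e k O a))
    (hf : ∀ a b, O a b → F (f k O a b) = F' (f k O a b)) : F = F' := by
  refine RingQuot.ringQuot_ext' _ _ _ (FreeAlgebra.hom_ext (funext ?_))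
  rintro (a | ⟨⟨a, b⟩, h⟩)
  · exact he a
  · have := hf a b h
    rwa [f_of_arrow k h] at this

theorem f_mul_f (a b c d : V) : f k O a b * f k O c d = 0 := by
  by_cases h₁ : O a b
  · by_cases h₂ : O c d
    · rw [f_of_arrow k h₁, f_of_arrow k h₂, ← map_mul]
      exact (RingQuot.mkAlgHom_rel k (OrRel.arrows_zero _ _)).trans (map_zero _)
    · rw [f_of_not_arrow k h₂, mul_zero]
  · rw [f_of_not_arrow k h₁, zero_mul]

/-- Induction principle for `B^red(Γ⁰)`: a property that holds for the idempotents and the arrows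
and is stable under the algebra operations holds everywhere. -/
theorem induction {motive : PathAlgebraRed k O → Prop}
    (algebraMap : ∀ r, motive (algebraMap k _ r)) (vertex : ∀ a, motive (e k O a))
    (arrow : ∀ a b, O a b → motive (f k O a b))
    (mul : ∀ y z, motive y → motive z → motive (y * z))
    (add : ∀ y z, motive y → motive z → motive (y + z)) (z : PathAlgebraRed k O) : motive z := by
  obtain ⟨z, rfl⟩ := RingQuot.mkAlgHom_surjective k (OrRel k O) z
  induction z using FreeAlgebra.induction with
  | grade0 r => rw [AlgHom.commutes]; exact algebraMap r
  | grade1 g =>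
    rcases g with a | ⟨⟨a, b⟩, h⟩
    · exact vertex a
    · rw [← f_of_arrow k h]; exact arrow a b h
  | mul y z hy hz => rw [map_mul]; exact mul _ _ hy hz
  | add y z hy hz => rw [map_add]; exact add _ _ hy hz

variable [DecidableEq V]

theorem e_mul_e (a b : V) : e k O a * e k O b = if a = b then e k O a else 0 := by
  split_ifs with h
  · subst h
    rw [e, ← map_mul]
    exact RingQuot.mkAlgHom_rel k (OrRel.idem a)
  · rw [e, e, ← map_mul]
    exact (RingQuot.mkAlgHom_rel k (OrRel.orth a b h)).trans (map_zero _)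

theorem e_mul_f (c a b : V) : e k O c * f k O a b = if c = b then f k O a b else 0 := by
  by_cases h : O a b
  · have hb : e k O b * f k O a b = f k O a b := by
      rw [f_of_arrow k h, e, ← map_mul]
      exact RingQuot.mkAlgHom_rel k (OrRel.target_id h)
    rw [← hb, ← mul_assoc, e_mul_e]
    split_ifs with hc
    · rw [hc]
    · rw [zero_mul]
  · simp [f_of_not_arrow k h]

theorem f_mul_e (c a b : V) : f k O a b * e k O c = if a = c then f k O a b else 0 := by
  by_cases h : O a b
  · have ha : f k O a b * e k O a = f k O a b := by
      rw [f_of_arrow k h, e, ← map_mul]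
      exact RingQuot.mkAlgHom_rel k (OrRel.source_id h)
    rw [← ha, mul_assoc, e_mul_e]
    split_ifs <;> simp
  · simp [f_of_not_arrow k h]

/-- The idempotents and the arrows span `B^red(Γ⁰)`. -/
theorem span_eq_top :
    Submodule.span k (Set.range (e k O) ∪ Set.range fun p : V × V => f k O p.1 p.2) = ⊤ := by
  set S := Submodule.span k (Set.range (e k O) ∪ Set.range fun p : V × V => f k O p.1 p.2)
  have he (a : V) : e k O a ∈ S := Submodule.subset_span (Or.inl ⟨a, rfl⟩)
  have hf (a b : V) : f k O a b ∈ S := Submodule.subset_span (Or.inr ⟨(a, b), rfl⟩)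
  have hmul : ∀ z, ∀ y ∈ S, z * y ∈ S := by
    intro z
    induction z using induction with
    | algebraMap r =>
      intro y hy
      rw [← Algebra.smul_def]
      exact S.smul_mem r hy
    | vertex c =>
      intro y hy
      induction hy using Submodule.span_induction with
      | mem y hy =>
        rcases hy with ⟨a, rfl⟩ | ⟨p, rfl⟩
        · rw [e_mul_e]; split_ifs; exacts [he _, S.zero_mem]
        · rw [e_mul_f]; split_ifs; exacts [hf _ _, S.zero_mem]
      | zero => rw [mul_zero]; exact S.zero_mem
      | add y z _ _ hy hz => rw [mul_add]; exact S.add_mem hy hz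
      | smul r y _ hy => rw [mul_smul_comm]; exact S.smul_mem r hy
    | arrow c d _ =>
      intro y hy
      induction hy using Submodule.span_induction with
      | mem y hy =>
        rcases hy with ⟨a, rfl⟩ | ⟨p, rfl⟩
        · rw [f_mul_e]; split_ifs; exacts [hf _ _, S.zero_mem]
        · rw [f_mul_f]; exact S.zero_mem
      | zero => rw [mul_zero]; exact S.zero_mem
      | add y z _ _ hy hz => rw [mul_add]; exact S.add_mem hy hz
      | smul r y _ hy => rw [mul_smul_comm]; exact S.smul_mem r hy
    | mul y z hy hz => intro w hw; rw [mul_assoc]; exact hy _ (hz _ hw)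
    | add y z hy hz => intro w hw; rw [add_mul]; exact S.add_mem (hy _ hw) (hz _ hw)
  refine Submodule.eq_top_iff'.2 fun z => ?_
  rw [← mul_one z, ← sum_e k]
  exact hmul z _ (S.sum_mem fun a _ => he a)

variable {k} in
/-- Linear maps out of `B^red(Γ⁰)` are determined by their values on idempotents and arrows. -/
theorem linearMap_ext {M : Type*} [AddCommMonoid M] [Module k M]
    {φ ψ : PathAlgebraRed k O →ₗ[k] M} (he : ∀ a, φ (e k O a) = ψ (e k O a))
    (hf : ∀ a b, O a b → φ (f k O a b) = ψ (f k O a b)) : φ = ψ := by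
  refine LinearMap.ext_on (span_eq_top k) ?_
  rintro _ (⟨a, rfl⟩ | ⟨⟨a, b⟩, rfl⟩)
  · exact he a
  · by_cases h : O a b
    · exact hf a b h
    · simp [f_of_not_arrow k h]

variable (O)

theorem exists_toMatrix : ∃ L : PathAlgebraRed k O →ₐ[k] Matrix V V (DualNumber k),
    (∀ a, L (e k O a) = Matrix.single a a 1) ∧
      ∀ a b, O a b → L (f k O a b) = Matrix.single b a DualNumber.eps := by
  refine exists_algHom _ _ ?_ ?_ Matrix.sum_single_one ?_ ?_ ?_
  · intro a; simp
  · intro a b h; simp [h]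
  · intro a b _; simp
  · intro a b _; simp
  · intro a b c d _ _
    by_cases h : a = d <;> simp [h]

/-- The representation of `B^red(Γ⁰)` by matrices over the dual numbers that sends `e_a` to the
diagonal matrix unit at `a` and an arrow `a → b` to `ε` times the matrix unit at `(b, a)`. -/
def toMatrix : PathAlgebraRed k O →ₐ[k] Matrix V V (DualNumber k) := (exists_toMatrix k O).choose

theorem toMatrix_e (a : V) : toMatrix k O (e k O a) = Matrix.single a a 1 :=
  (exists_toMatrix k O).choose_spec.1 a

variable {O} in
theorem toMatrix_f {a b : V} (h : O a b) :
    toMatrix k O (f k O a b) = Matrix.single b a DualNumber.eps :=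
  (exists_toMatrix k O).choose_spec.2 a b h

/-- The linear form on `B^red(Γ⁰)` dual to the idempotent `e_a`. -/
def vertexCoeff (a : V) : Module.Dual k (PathAlgebraRed k O) :=
  (TrivSqZeroExt.fstHom k k k).toLinearMap ∘ₗ Matrix.entryLinearMap k (DualNumber k) a a ∘ₗ
    (toMatrix k O).toLinearMap

/-- The linear form on `B^red(Γ⁰)` dual to the arrow `a → b`; it is zero if there is none. -/
def arrowCoeff (a b : V) : Module.Dual k (PathAlgebraRed k O) :=
  TrivSqZeroExt.sndHom k k ∘ₗ Matrix.entryLinearMap k (DualNumber k) b a ∘ₗ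
    (toMatrix k O).toLinearMap

theorem vertexCoeff_e (a b : V) : vertexCoeff k O a (e k O b) = if a = b then 1 else 0 := by
  by_cases h : a = b <;> simp [vertexCoeff, toMatrix_e, h, eq_comm]

theorem vertexCoeff_f (a b c : V) : vertexCoeff k O a (f k O b c) = 0 := by
  by_cases h : O b c
  · simp only [vertexCoeff, LinearMap.comp_apply, AlgHom.toLinearMap_apply, toMatrix_f k h,
      Matrix.entryLinearMap_apply, Matrix.single_apply]
    split_ifs <;> simp
  · simp [f_of_not_arrow k h]

theorem arrowCoeff_e (a b c : V) : arrowCoeff k O a b (e k O c) = 0 := by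
  simp only [arrowCoeff, LinearMap.comp_apply, AlgHom.toLinearMap_apply, toMatrix_e,
    Matrix.entryLinearMap_apply, Matrix.single_apply]
  split_ifs <;> simp

variable {O} in
theorem arrowCoeff_f {c d : V} (h : O c d) (a b : V) :
    arrowCoeff k O a b (f k O c d) = if a = c ∧ b = d then 1 else 0 := by
  simp only [arrowCoeff, LinearMap.comp_apply, AlgHom.toLinearMap_apply, toMatrix_f k h,
    Matrix.entryLinearMap_apply, Matrix.single_apply]
  simp only [eq_comm (a := c), eq_comm (a := d), and_comm (a := b = d)]
  split_ifs <;> simp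

variable {O} in
theorem arrowCoeff_of_not_arrow {a b : V} (h : ¬ O a b) : arrowCoeff k O a b = 0 :=
  linearMap_ext (fun c => by simp [arrowCoeff_e]) fun c d hcd => by
    rw [arrowCoeff_f k hcd, if_neg (by rintro ⟨rfl, rfl⟩; exact h hcd), LinearMap.zero_apply]

end PathAlgebraRed

namespace PathAlgebraRed

open ZigzagAlgebra (loop x)

section Dual

variable (B : Type) [Ring B] [Algebra ℂ B]

theorem dual_smul_apply (y : B) (φ : Module.Dual ℂ B) (z : B) : (y • φ) z = φ (z * y) := rfl

theorem dual_op_smul_apply (y : B) (φ : Module.Dual ℂ B) (z : B) :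
    (MulOpposite.op y • φ) z = φ (y * z) := rfl

variable {B}

theorem inl_mul_inl_add_inr (y z : B) (ψ : Module.Dual ℂ B) :
    (TrivSqZeroExt.inl y : TrivSqZeroExt B (Module.Dual ℂ B)) *
      (TrivSqZeroExt.inl z + TrivSqZeroExt.inr ψ) =
        TrivSqZeroExt.inl (y * z) + TrivSqZeroExt.inr (y • ψ) := by
  rw [mul_add, TrivSqZeroExt.inl_mul, TrivSqZeroExt.inl_mul_inr]

theorem inl_add_inr_mul_inl (y z : B) (φ : Module.Dual ℂ B) :
    (TrivSqZeroExt.inl y + TrivSqZeroExt.inr φ : TrivSqZeroExt B (Module.Dual ℂ B)) *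
      TrivSqZeroExt.inl z =
        TrivSqZeroExt.inl (y * z) + TrivSqZeroExt.inr (MulOpposite.op z • φ) := by
  rw [add_mul, TrivSqZeroExt.inl_mul, TrivSqZeroExt.inr_mul_inl]

theorem inl_add_inr_mul_inl_add_inr {y z : B} (h : y * z = 0) (φ ψ : Module.Dual ℂ B) :
    (TrivSqZeroExt.inl y + TrivSqZeroExt.inr φ : TrivSqZeroExt B (Module.Dual ℂ B)) *
      (TrivSqZeroExt.inl z + TrivSqZeroExt.inr ψ) =
        TrivSqZeroExt.inr (y • ψ + MulOpposite.op z • φ) := by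
  rw [mul_add, inl_add_inr_mul_inl, h, TrivSqZeroExt.inl_zero, zero_add, add_mul,
    TrivSqZeroExt.inl_mul_inr, TrivSqZeroExt.inr_mul_inr, add_zero, TrivSqZeroExt.inr_add,
    add_comm]

end Dual

variable {V : Type} [Fintype V] (G : SimpleGraph V) (O : V → V → Prop)

/-- The linear map from the dual of `B^red(Γ⁰)` to the zigzag algebra of `Γ` that sends the form
dual to `e_a` to the loop at `a` and the form dual to an arrow `a → b` to `x_{ba}`. -/
def dualToZigzag : Module.Dual ℂ (PathAlgebraRed ℂ O) →ₗ[ℂ] ZigzagAlgebra ℂ G :=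
  ∑ a, (LinearMap.applyₗ (e ℂ O a)).smulRight (loop ℂ G a) +
    ∑ a, ∑ b, (LinearMap.applyₗ (f ℂ O a b)).smulRight (x ℂ G b a)

theorem dualToZigzag_apply (φ : Module.Dual ℂ (PathAlgebraRed ℂ O)) :
    dualToZigzag G O φ =
      ∑ a, φ (e ℂ O a) • loop ℂ G a + ∑ a, ∑ b, φ (f ℂ O a b) • x ℂ G b a := by
  simp [dualToZigzag, LinearMap.sum_apply]

variable {G O}

theorem f_smul_of_not_arrow {a b : V} (h : ¬ O a b) (φ : Module.Dual ℂ (PathAlgebraRed ℂ O)) :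
    f ℂ O a b • φ = 0 :=
  LinearMap.ext fun z => by
    rw [dual_smul_apply, f_of_not_arrow ℂ h, mul_zero, map_zero, LinearMap.zero_apply]

theorem op_f_smul_of_not_arrow {a b : V} (h : ¬ O a b)
    (φ : Module.Dual ℂ (PathAlgebraRed ℂ O)) : MulOpposite.op (f ℂ O a b) • φ = 0 :=
  LinearMap.ext fun z => by
    rw [dual_op_smul_apply, f_of_not_arrow ℂ h, zero_mul, map_zero, LinearMap.zero_apply]

variable [DecidableEq V]

theorem dualToZigzag_mul (hconn : G.Connected) (hcard : 2 < Fintype.card V)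
    (hOanti : ∀ a b, ¬ (O a b ∧ O b a)) (φ ψ : Module.Dual ℂ (PathAlgebraRed ℂ O)) :
    dualToZigzag G O φ * dualToZigzag G O ψ = 0 := by
  have hxx (a b c d : V) :
      φ (f ℂ O a b) • x ℂ G b a * ψ (f ℂ O c d) • x ℂ G d c = 0 := by
    by_cases hab : O a b
    · by_cases hcd : O c d
      · rw [smul_mul_smul_comm, ZigzagAlgebra.x_mul_x_of_ne, smul_zero]
        rintro ⟨rfl, rfl⟩
        exact hOanti _ _ ⟨hab, hcd⟩
      · simp [f_of_not_arrow ℂ hcd]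
    · simp [f_of_not_arrow ℂ hab]
  simp only [dualToZigzag_apply, add_mul, mul_add, Finset.sum_mul, Finset.mul_sum, hxx]
  simp [ZigzagAlgebra.loop_mul_loop ℂ hconn hcard, ZigzagAlgebra.loop_mul_x ℂ hconn hcard,
    ZigzagAlgebra.x_mul_loop ℂ hconn hcard]

theorem exists_toZigzag (hOanti : ∀ a b, ¬ (O a b ∧ O b a)) :
    ∃ L : PathAlgebraRed ℂ O →ₐ[ℂ] ZigzagAlgebra ℂ G,
      (∀ a, L (e ℂ O a) = ZigzagAlgebra.e ℂ G a) ∧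
        ∀ a b, O a b → L (f ℂ O a b) = x ℂ G a b := by
  refine exists_algHom _ _ ?_ ?_ (ZigzagAlgebra.sum_e ℂ) ?_ ?_ ?_
  · intro a; rw [ZigzagAlgebra.e_mul_e, if_pos rfl]
  · intro a b h; rw [ZigzagAlgebra.e_mul_e, if_neg h]
  · intro a b _; rw [ZigzagAlgebra.e_mul_x, if_pos rfl]
  · intro a b _; rw [ZigzagAlgebra.x_mul_e, if_pos rfl]
  · intro a b c d hab hcd
    refine ZigzagAlgebra.x_mul_x_of_ne ℂ ?_
    rintro ⟨rfl, rfl⟩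
    exact hOanti _ _ ⟨hab, hcd⟩

theorem dualToZigzag_smul (hconn : G.Connected) (hcard : 2 < Fintype.card V)
    (hOadj : ∀ a b, O a b → G.Adj a b)
    {L : PathAlgebraRed ℂ O →ₐ[ℂ] ZigzagAlgebra ℂ G}
    (hLe : ∀ a, L (e ℂ O a) = ZigzagAlgebra.e ℂ G a)
    (hLf : ∀ a b, O a b → L (f ℂ O a b) = x ℂ G a b)
    (y : PathAlgebraRed ℂ O) (φ : Module.Dual ℂ (PathAlgebraRed ℂ O)) :
    dualToZigzag G O (y • φ) = L y * dualToZigzag G O φ := by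
  induction y using induction generalizing φ with
  | algebraMap r => rw [algebraMap_smul, map_smul, AlgHom.commutes, ← Algebra.smul_def]
  | vertex c =>
    simp [dualToZigzag_apply, dual_smul_apply, hLe, mul_add, Finset.mul_sum, e_mul_e, f_mul_e,
      ZigzagAlgebra.e_mul_loop, ZigzagAlgebra.e_mul_x, apply_ite φ, ite_smul, smul_ite]
  | arrow c d hcd =>
    have hxx (a b : V) : φ (f ℂ O a b) • (x ℂ G c d * x ℂ G b a) =
        if a = c then if b = d then φ (f ℂ O c d) • loop ℂ G d else 0 else 0 := by
      rw [← ite_and]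
      split_ifs with h
      · rw [h.1, h.2, ZigzagAlgebra.x_mul_x_eq_loop ℂ (hOadj c d hcd).symm]
      · rw [ZigzagAlgebra.x_mul_x_of_ne ℂ (by tauto), smul_zero]
    simp [dualToZigzag_apply, dual_smul_apply, hLf c d hcd, mul_add, Finset.mul_sum, e_mul_f,
      f_mul_f, ZigzagAlgebra.x_mul_loop ℂ hconn hcard, hxx, apply_ite φ, ite_smul]
  | mul y z hy hz => rw [mul_smul, hy, hz, map_mul, mul_assoc]
  | add y z hy hz => rw [add_smul, map_add, hy, hz, map_add, add_mul]

theorem dualToZigzag_op_smul (hconn : G.Connected) (hcard : 2 < Fintype.card V)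
    (hOadj : ∀ a b, O a b → G.Adj a b)
    {L : PathAlgebraRed ℂ O →ₐ[ℂ] ZigzagAlgebra ℂ G}
    (hLe : ∀ a, L (e ℂ O a) = ZigzagAlgebra.e ℂ G a)
    (hLf : ∀ a b, O a b → L (f ℂ O a b) = x ℂ G a b)
    (y : PathAlgebraRed ℂ O) (φ : Module.Dual ℂ (PathAlgebraRed ℂ O)) :
    dualToZigzag G O (MulOpposite.op y • φ) = dualToZigzag G O φ * L y := by
  induction y using induction generalizing φ with
  | algebraMap r =>
    rw [← MulOpposite.algebraMap_apply, algebraMap_smul, map_smul, AlgHom.commutes,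
      ← Algebra.commutes, ← Algebra.smul_def]
  | vertex c =>
    simp [dualToZigzag_apply, dual_op_smul_apply, hLe, add_mul, Finset.sum_mul, e_mul_e, e_mul_f,
      ZigzagAlgebra.loop_mul_e, ZigzagAlgebra.x_mul_e, apply_ite φ, ite_smul, smul_ite]
  | arrow c d hcd =>
    have hxx (a b : V) : φ (f ℂ O a b) • (x ℂ G b a * x ℂ G c d) =
        if a = c then if b = d then φ (f ℂ O c d) • loop ℂ G c else 0 else 0 := by
      rw [← ite_and]
      split_ifs with h
      · rw [h.1, h.2, ZigzagAlgebra.x_mul_x_eq_loop ℂ (hOadj c d hcd)]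
      · rw [ZigzagAlgebra.x_mul_x_of_ne ℂ (by tauto), smul_zero]
    simp [dualToZigzag_apply, dual_op_smul_apply, hLf c d hcd, add_mul, Finset.sum_mul, f_mul_e,
      f_mul_f, ZigzagAlgebra.loop_mul_x ℂ hconn hcard, hxx, apply_ite φ, ite_smul]
  | mul y z hy hz => rw [MulOpposite.op_mul, mul_smul, hz, hy, map_mul, mul_assoc]
  | add y z hy hz => rw [MulOpposite.op_add, add_smul, map_add, hy, hz, map_add, mul_add]

theorem dualToZigzag_arrowCoeff {a b : V} (h : O a b) :
    dualToZigzag G O (arrowCoeff ℂ O a b) = x ℂ G b a := by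
  have hsum (c d : V) : arrowCoeff ℂ O a b (f ℂ O c d) • x ℂ G d c =
      if a = c then if b = d then x ℂ G b a else 0 else 0 := by
    rw [← ite_and]
    by_cases hcd : O c d
    · rw [arrowCoeff_f ℂ hcd]
      split_ifs with hab
      · rw [hab.1, hab.2, one_smul]
      · rw [zero_smul]
    · rw [f_of_not_arrow ℂ hcd, map_zero, zero_smul, if_neg]
      rintro ⟨rfl, rfl⟩
      exact hcd h
  simp [dualToZigzag_apply, arrowCoeff_e, hsum]

theorem e_smul_arrowCoeff (a b : V) : e ℂ O a • arrowCoeff ℂ O a b = arrowCoeff ℂ O a b := by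
  refine linearMap_ext (fun c => ?_) fun c d hcd => ?_
  · rw [dual_smul_apply, e_mul_e]
    split_ifs <;> simp [arrowCoeff_e]
  · rw [dual_smul_apply, f_mul_e]
    split_ifs with h
    · rfl
    · rw [map_zero, arrowCoeff_f ℂ hcd, if_neg (by tauto)]

theorem op_e_smul_arrowCoeff (a b : V) :
    MulOpposite.op (e ℂ O b) • arrowCoeff ℂ O a b = arrowCoeff ℂ O a b := by
  refine linearMap_ext (fun c => ?_) fun c d hcd => ?_
  · rw [dual_op_smul_apply, e_mul_e]
    split_ifs <;> simp [arrowCoeff_e]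
  · rw [dual_op_smul_apply, e_mul_f]
    split_ifs with h
    · rfl
    · rw [map_zero, arrowCoeff_f ℂ hcd, if_neg (by tauto)]

theorem f_smul_arrowCoeff_of_ne {a b c : V} (h : c ≠ a) :
    f ℂ O b c • arrowCoeff ℂ O b a = 0 := by
  by_cases hbc : O b c
  · refine linearMap_ext (fun d => ?_) fun d d' _ => ?_
    · rw [dual_smul_apply, e_mul_f]
      split_ifs
      · rw [arrowCoeff_f ℂ hbc, if_neg (by tauto), LinearMap.zero_apply]
      · simp
    · simp [dual_smul_apply, f_mul_f]
  · exact f_smul_of_not_arrow hbc _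

theorem op_f_smul_arrowCoeff_of_ne {a b c : V} (h : c ≠ a) :
    MulOpposite.op (f ℂ O a b) • arrowCoeff ℂ O c b = 0 := by
  by_cases hab : O a b
  · refine linearMap_ext (fun d => ?_) fun d d' _ => ?_
    · rw [dual_op_smul_apply, f_mul_e]
      split_ifs
      · rw [arrowCoeff_f ℂ hab, if_neg (by tauto), LinearMap.zero_apply]
      · simp
    · simp [dual_op_smul_apply, f_mul_f]
  · exact op_f_smul_of_not_arrow hab _

theorem f_smul_arrowCoeff {a b : V} (h : O b a) :
    f ℂ O b a • arrowCoeff ℂ O b a = vertexCoeff ℂ O a := by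
  refine linearMap_ext (fun d => ?_) fun d d' _ => ?_
  · rw [dual_smul_apply, e_mul_f, vertexCoeff_e]
    by_cases hd : d = a
    · simp [hd, arrowCoeff_f ℂ h]
    · simp [hd, Ne.symm hd]
  · simp [dual_smul_apply, f_mul_f, vertexCoeff_f]

theorem op_f_smul_arrowCoeff {a b : V} (h : O a b) :
    MulOpposite.op (f ℂ O a b) • arrowCoeff ℂ O a b = vertexCoeff ℂ O a := by
  refine linearMap_ext (fun d => ?_) fun d d' _ => ?_
  · rw [dual_op_smul_apply, f_mul_e, vertexCoeff_e]
    split_ifs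
    · simp [arrowCoeff_f ℂ h]
    · exact map_zero _
  · simp [dual_op_smul_apply, f_mul_f, vertexCoeff_f]

/-- Expansion of a linear form on `B^red(Γ⁰)` in the dual basis. -/
theorem eq_sum_coeff (φ : Module.Dual ℂ (PathAlgebraRed ℂ O)) :
    φ = ∑ a, φ (e ℂ O a) • vertexCoeff ℂ O a +
      ∑ a, ∑ b, φ (f ℂ O a b) • arrowCoeff ℂ O a b := by
  refine linearMap_ext (fun c => ?_) fun c d hcd => ?_
  · simp [LinearMap.sum_apply, vertexCoeff_e, arrowCoeff_e]
  · simp [LinearMap.sum_apply, vertexCoeff_f, arrowCoeff_f ℂ hcd, ite_and]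

variable (O) in
/-- The image in the trivial extension of the arrow `x_{ab}` of the zigzag algebra: the arrow
`a → b` of `Γ⁰` if there is one, and the form dual to the arrow `b → a` otherwise. -/
def zigzagArrow (a b : V) :
    TrivSqZeroExt (PathAlgebraRed ℂ O) (Module.Dual ℂ (PathAlgebraRed ℂ O)) :=
  TrivSqZeroExt.inl (f ℂ O a b) + TrivSqZeroExt.inr (arrowCoeff ℂ O b a)

theorem zigzagArrow_mul (a b c : V) : zigzagArrow O b c * zigzagArrow O a b =
    TrivSqZeroExt.inr (f ℂ O b c • arrowCoeff ℂ O b a +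
      MulOpposite.op (f ℂ O a b) • arrowCoeff ℂ O c b) :=
  inl_add_inr_mul_inl_add_inr (f_mul_f ℂ _ _ _ _) _ _

theorem zigzagArrow_mul_of_ne {a b c : V} (h : c ≠ a) :
    zigzagArrow O b c * zigzagArrow O a b = 0 := by
  rw [zigzagArrow_mul, f_smul_arrowCoeff_of_ne h, op_f_smul_arrowCoeff_of_ne h, add_zero,
    TrivSqZeroExt.inr_zero]

theorem zigzagArrow_mul_symm (hOcover : ∀ a b, G.Adj a b → O a b ∨ O b a)
    (hOanti : ∀ a b, ¬ (O a b ∧ O b a)) {a b : V} (h : G.Adj a b) :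
    zigzagArrow O b a * zigzagArrow O a b = TrivSqZeroExt.inr (vertexCoeff ℂ O a) := by
  rw [zigzagArrow_mul]
  rcases hOcover a b h with hab | hba
  · rw [f_smul_of_not_arrow fun hba => hOanti a b ⟨hab, hba⟩, zero_add,
      op_f_smul_arrowCoeff hab]
  · rw [op_f_smul_of_not_arrow fun hab => hOanti a b ⟨hab, hba⟩, add_zero,
      f_smul_arrowCoeff hba]

theorem exists_ofZigzag (hOcover : ∀ a b, G.Adj a b → O a b ∨ O b a)
    (hOanti : ∀ a b, ¬ (O a b ∧ O b a)) :
    ∃ F : ZigzagAlgebra ℂ G →ₐ[ℂ]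
        TrivSqZeroExt (PathAlgebraRed ℂ O) (Module.Dual ℂ (PathAlgebraRed ℂ O)),
      (∀ a, F (ZigzagAlgebra.e ℂ G a) = TrivSqZeroExt.inl (e ℂ O a)) ∧
        ∀ a b, G.Adj a b → F (x ℂ G a b) = zigzagArrow O a b := by
  refine ZigzagAlgebra.exists_algHom (fun a => TrivSqZeroExt.inl (e ℂ O a)) (zigzagArrow O)
    ?_ ?_ ?_ ?_ ?_ ?_ ?_
  · intro a
    rw [← TrivSqZeroExt.inl_mul, e_mul_e, if_pos rfl]
  · intro a b h
    rw [← TrivSqZeroExt.inl_mul, e_mul_e, if_neg h, TrivSqZeroExt.inl_zero]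
  · rw [← TrivSqZeroExt.inl_sum, sum_e, TrivSqZeroExt.inl_one]
  · intro a b _
    refine (inl_mul_inl_add_inr _ _ _).trans ?_
    rw [e_mul_f, if_pos rfl, e_smul_arrowCoeff, zigzagArrow]
  · intro a b _
    refine (inl_add_inr_mul_inl _ _ _).trans ?_
    rw [f_mul_e, if_pos rfl, op_e_smul_arrowCoeff, zigzagArrow]
  · intro a b c _ _ h
    exact zigzagArrow_mul_of_ne h
  · intro a b c hab hac
    exact (zigzagArrow_mul_symm hOcover hOanti hab).trans
      (zigzagArrow_mul_symm hOcover hOanti hac).symm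

end PathAlgebraRed

/-- for any orientation `Γ⁰` of `Γ`, the zigzag algebra `A(Γ)` is
isomorphic as a `ℂ`-algebra to the trivial extension algebra `T(B) = B ⊕ B*` of
`B = B^red(Γ⁰)`, where `B*` carries the bimodule structure `(x·f·y)(z) = f(yzx)` and
the multiplication is `(x, f)(y, g) = (xy, xg + fy)`. -/
theorem zigzagAlgebra_iso_trivialExtension {V : Type} [Fintype V] [DecidableEq V]
    (G : SimpleGraph V) [DecidableRel G.Adj]
    (hconn : G.Connected) (hcard : 2 < Fintype.card V)
    (O : V → V → Prop)
    (hOadj : ∀ a b : V, O a b → G.Adj a b)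
    (hOcover : ∀ a b : V, G.Adj a b → (O a b ∨ O b a))
    (hOanti : ∀ a b : V, ¬ (O a b ∧ O b a)) :
    Nonempty
      (ZigzagAlgebra ℂ G ≃ₐ[ℂ]
        TrivSqZeroExt (PathAlgebraRed ℂ O) (Module.Dual ℂ (PathAlgebraRed ℂ O))) := by
  obtain ⟨F, hFe, hFx⟩ := PathAlgebraRed.exists_ofZigzag hOcover hOanti
  obtain ⟨L, hLe, hLf⟩ := PathAlgebraRed.exists_toZigzag (G := G) hOanti
  have hFloop (a : V) : F (ZigzagAlgebra.loop ℂ G a) =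
      TrivSqZeroExt.inr (PathAlgebraRed.vertexCoeff ℂ O a) := by
    obtain ⟨b, hb⟩ := hconn.exists_adj_of_two_lt_card hcard a
    rw [← ZigzagAlgebra.x_mul_x_eq_loop ℂ hb, map_mul, hFx _ _ hb, hFx _ _ hb.symm,
      PathAlgebraRed.zigzagArrow_mul_symm hOcover hOanti hb]
  have hFarrow (φ : Module.Dual ℂ (PathAlgebraRed ℂ O)) (a b : V) :
      φ (PathAlgebraRed.f ℂ O a b) • F (ZigzagAlgebra.x ℂ G b a) =
        φ (PathAlgebraRed.f ℂ O a b) • TrivSqZeroExt.inr (PathAlgebraRed.arrowCoeff ℂ O a b) := by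
    by_cases hab : O a b
    · rw [hFx _ _ (hOadj a b hab).symm, PathAlgebraRed.zigzagArrow,
        PathAlgebraRed.f_of_not_arrow ℂ fun hba => hOanti a b ⟨hab, hba⟩, TrivSqZeroExt.inl_zero,
        zero_add]
    · simp [PathAlgebraRed.f_of_not_arrow ℂ hab]
  refine ⟨AlgEquiv.ofAlgHom F
    (TrivSqZeroExt.lift L (PathAlgebraRed.dualToZigzag G O)
      (PathAlgebraRed.dualToZigzag_mul hconn hcard hOanti)
      (PathAlgebraRed.dualToZigzag_smul hconn hcard hOadj hLe hLf)
      (PathAlgebraRed.dualToZigzag_op_smul hconn hcard hOadj hLe hLf)) ?_ ?_⟩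
  · refine TrivSqZeroExt.algHom_ext' (PathAlgebraRed.algHom_ext (fun a => ?_) fun a b hab => ?_)
      (LinearMap.ext fun φ => ?_)
    · simp [hLe, hFe]
    · simp [hLf a b hab, hFx a b (hOadj a b hab), PathAlgebraRed.zigzagArrow,
        PathAlgebraRed.arrowCoeff_of_not_arrow ℂ fun hba => hOanti a b ⟨hab, hba⟩]
    · conv_rhs => rw [PathAlgebraRed.eq_sum_coeff φ]
      simp [PathAlgebraRed.dualToZigzag_apply, hFloop, hFarrow, TrivSqZeroExt.inr_sum]
  · refine ZigzagAlgebra.algHom_ext (fun a => ?_) fun a b hab => ?_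
    · simp [hFe, hLe]
    · rcases hOcover a b hab with h | h
      · simp [hFx a b hab, PathAlgebraRed.zigzagArrow, hLf a b h,
          PathAlgebraRed.arrowCoeff_of_not_arrow ℂ fun hba => hOanti a b ⟨h, hba⟩]
      · simp [hFx a b hab, PathAlgebraRed.zigzagArrow, PathAlgebraRed.dualToZigzag_arrowCoeff h,
          PathAlgebraRed.f_of_not_arrow ℂ fun hab => hOanti a b ⟨hab, h⟩]

end
end

section
/- For simple roots α, β ∈ Π with (α,β) = 0, the operators on R satisfy F_α F_β = F_β F_α; and for α, β ∈ Π with (α,β) = −1, they satisfy the quantum Serre relation F_α² F_β − (q + q⁻¹) F_α F_β F_α + F_β F_α² = 0 as ℚ(q)-linear endomorphisms of R. -/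
/-!
The adjoint representation of a simply-laced quantum group, realized concretely on the
`ℚ(q)`-vector space with basis `{x_μ : μ ∈ Φ} ∪ {h_α : α ∈ Π}`.
-/

noncomputable section

open Polynomial

/-- The field `ℚ(q)` of rational functions over `ℚ`. -/
abbrev Qq : Type := RatFunc ℚ

/-- The indeterminate `q ∈ ℚ(q)`. -/
def qv : Qq := RatFunc.X

/-- A datum abstracting a simply-laced root system `Φ` with base `Π`, normalized so that
`(α, α) = 2` for roots: a symmetric bilinear form `B` together with the standard
combinatorial facts about pairings of roots and simple roots that hold in any finite
reduced irreducible crystallographic simply-laced root system. -/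
structure SimplyLacedDatum (E : Type) [AddCommGroup E] [Module ℚ E] where
  /-- the inner product `(·,·)` -/
  B : E →ₗ[ℚ] E →ₗ[ℚ] ℚ
  symm : ∀ x y : E, B x y = B y x
  /-- the set of roots `Φ` -/
  Phi : Set E
  /-- the base `Π` of simple roots -/
  Base : Set E
  base_sub : Base ⊆ Phi
  phi_finite : Phi.Finite
  zero_not_mem : (0 : E) ∉ Phi
  crystallographic : ∀ μ ∈ Phi, ∀ ν ∈ Phi, ∃ n : ℤ, B μ ν = n
  norm_two : ∀ μ ∈ Phi, B μ μ = 2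
  neg_mem : ∀ μ ∈ Phi, -μ ∈ Phi
  base_pair : ∀ α ∈ Base, ∀ β ∈ Base, α ≠ β → B α β = 0 ∨ B α β = -1
  pair_range : ∀ μ ∈ Phi, ∀ α ∈ Base,
      B μ α = -2 ∨ B μ α = -1 ∨ B μ α = 0 ∨ B μ α = 1 ∨ B μ α = 2
  pair_two_iff : ∀ μ ∈ Phi, ∀ α ∈ Base, (B μ α = 2 ↔ μ = α)
  pair_neg_two_iff : ∀ μ ∈ Phi, ∀ α ∈ Base, (B μ α = -2 ↔ μ = -α)
  add_mem : ∀ μ ∈ Phi, ∀ α ∈ Base, B μ α = -1 → μ + α ∈ Phi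
  sub_mem : ∀ μ ∈ Phi, ∀ α ∈ Base, B μ α = 1 → μ - α ∈ Phi

namespace SimplyLacedDatum

variable {E : Type} [AddCommGroup E] [Module ℚ E] (D : SimplyLacedDatum E)

/-- The index set for the canonical basis of the adjoint representation:
one index for each root `μ ∈ Φ` (the vector `x_μ`) and one for each simple root
`α ∈ Π` (the vector `h_α`). -/
def Idx : Type := {μ : E // μ ∈ D.Phi} ⊕ {α : E // α ∈ D.Base}

/-- The adjoint representation `R`, as the free `ℚ(q)`-module on `Idx`. -/
def R : Type := D.Idx →₀ Qq

instance : AddCommGroup D.R := inferInstanceAs (AddCommGroup (D.Idx →₀ Qq))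
instance : Module Qq D.R := inferInstanceAs (Module Qq (D.Idx →₀ Qq))

/-- The canonical basis vector `x_μ`, for a root `μ ∈ Φ`. -/
def xv (μ : E) (h : μ ∈ D.Phi) : D.R := Finsupp.single (Sum.inl ⟨μ, h⟩) 1

/-- The canonical basis vector `h_α`, for a simple root `α ∈ Π`. -/
def hv (α : E) (h : α ∈ D.Base) : D.R := Finsupp.single (Sum.inr ⟨α, h⟩) 1

/-- The `ℚ(q)`-linear operator on `R` sending the basis vector indexed by `i` to `v i`. -/
def opOf (v : D.Idx → D.R) : D.R →ₗ[Qq] D.R :=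
  Finsupp.lsum Qq fun i => LinearMap.toSpanSingleton Qq D.R (v i)

open Classical in
/-- The images of the basis vectors under `E_α`. -/
def Evec (α : E) (hα : α ∈ D.Base) : D.Idx → D.R := fun i =>
  match i with
  | Sum.inl μ =>
      if h : D.B μ.1 α = -1 then D.xv (μ.1 + α) (D.add_mem μ.1 μ.2 α hα h)
      else if D.B μ.1 α = -2 then D.hv α hα
      else 0
  | Sum.inr β =>
      if β.1 = α then (qv + qv⁻¹) • D.xv α (D.base_sub hα)
      else if D.B β.1 α = -1 then D.xv α (D.base_sub hα)
      else 0

open Classical in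
/-- The images of the basis vectors under `F_α`. -/
def Fvec (α : E) (hα : α ∈ D.Base) : D.Idx → D.R := fun i =>
  match i with
  | Sum.inl μ =>
      if h : D.B μ.1 α = 1 then D.xv (μ.1 - α) (D.sub_mem μ.1 μ.2 α hα h)
      else if D.B μ.1 α = 2 then D.hv α hα
      else 0
  | Sum.inr β =>
      if β.1 = α then (qv + qv⁻¹) • D.xv (-α) (D.neg_mem α (D.base_sub hα))
      else if D.B β.1 α = -1 then D.xv (-α) (D.neg_mem α (D.base_sub hα))
      else 0

/-- The images of the basis vectors under `K_α`: `K_α x_μ = q^{(α,μ)} x_μ`,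
`K_α h_β = h_β`. -/
def Kvec (α : E) (hα : α ∈ D.Base) : D.Idx → D.R := fun i =>
  match i with
  | Sum.inl μ => qv ^ (D.B α μ.1).num • D.xv μ.1 μ.2
  | Sum.inr β => D.hv β.1 β.2

/-- The images of the basis vectors under `K_α⁻¹`: `K_α⁻¹ x_μ = q^{−(α,μ)} x_μ`,
`K_α⁻¹ h_β = h_β`. -/
def Kinvvec (α : E) (hα : α ∈ D.Base) : D.Idx → D.R := fun i =>
  match i with
  | Sum.inl μ => qv ^ (-(D.B α μ.1).num) • D.xv μ.1 μ.2
  | Sum.inr β => D.hv β.1 β.2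

/-- The operator `E_α` on the adjoint representation. -/
def opE (α : E) (hα : α ∈ D.Base) : D.R →ₗ[Qq] D.R := D.opOf (D.Evec α hα)

/-- The operator `F_α` on the adjoint representation. -/
def opF (α : E) (hα : α ∈ D.Base) : D.R →ₗ[Qq] D.R := D.opOf (D.Fvec α hα)

/-- The operator `K_α` on the adjoint representation. -/
def opK (α : E) (hα : α ∈ D.Base) : D.R →ₗ[Qq] D.R := D.opOf (D.Kvec α hα)

/-- The operator `K_α⁻¹` on the adjoint representation. -/
def opKinv (α : E) (hα : α ∈ D.Base) : D.R →ₗ[Qq] D.R := D.opOf (D.Kinvvec α hα)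

end SimplyLacedDatum

end

namespace SimplyLacedDatum

variable {E : Type} [AddCommGroup E] [Module ℚ E] (D : SimplyLacedDatum E)

lemma opOf_single (v : D.Idx → D.R) (i : D.Idx) :
    D.opOf v (Finsupp.single i 1 : D.Idx →₀ Qq) = v i := by
  refine (Finsupp.lsum_single _ _ _ _).trans ?_
  simp [LinearMap.toSpanSingleton_apply]

/-- Two operators on `R` agree as soon as they agree on the canonical basis. -/
lemma hom_ext {f g : D.R →ₗ[Qq] D.R} (hx : ∀ μ h, f (D.xv μ h) = g (D.xv μ h))
    (hh : ∀ γ h, f (D.hv γ h) = g (D.hv γ h)) : f = g := by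
  refine Finsupp.lhom_ext' fun i => LinearMap.ext_ring ?_
  rcases i with ⟨μ, h⟩ | ⟨γ, h⟩
  · exact hx μ h
  · exact hh γ h

variable {D} {α : E} (hα : α ∈ D.Base)

lemma opF_xv_of_one {μ ν : E} (hμ : μ ∈ D.Phi) (h : D.B μ α = 1) (e : μ - α = ν) (hν : ν ∈ D.Phi) :
    D.opF α hα (D.xv μ hμ) = D.xv ν hν := by
  subst e
  refine (D.opOf_single _ _).trans ?_
  simp [Fvec, h]

lemma opF_xv_self (h : α ∈ D.Phi) : D.opF α hα (D.xv α h) = D.hv α hα := by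
  refine (D.opOf_single _ _).trans ?_
  simp [Fvec, D.norm_two α h]

lemma opF_xv_of_nonpos {μ : E} (hμ : μ ∈ D.Phi) (h : D.B μ α ≤ 0) :
    D.opF α hα (D.xv μ hμ) = 0 := by
  refine (D.opOf_single _ _).trans ?_
  have h1 : D.B μ α ≠ 1 := by linarith
  have h2 : D.B μ α ≠ 2 := by linarith
  simp [Fvec, h1, h2]

lemma opF_hv_self : D.opF α hα (D.hv α hα) =
    (qv + qv⁻¹) • D.xv (-α) (D.neg_mem α (D.base_sub hα)) := by
  refine (D.opOf_single _ _).trans ?_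
  simp [Fvec]

lemma opF_hv_of_ne {γ : E} (hγ : γ ∈ D.Base) (h : D.B γ α ≠ 2) :
    D.opF α hα (D.hv γ hγ) =
      if D.B γ α = -1 then D.xv (-α) (D.neg_mem α (D.base_sub hα)) else 0 := by
  refine (D.opOf_single _ _).trans ?_
  have h1 : γ ≠ α := by
    rintro rfl
    exact h (D.norm_two _ (D.base_sub hγ))
  simp [Fvec, h1]

/-- `F_α` maps the span of the `h_γ` into the line through `x_{-α}`. -/
lemma exists_opF_hv_eq_smul {γ : E} (hγ : γ ∈ D.Base) : ∃ c : Qq,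
    D.opF α hα (D.hv γ hγ) = c • D.xv (-α) (D.neg_mem α (D.base_sub hα)) := by
  by_cases h : γ = α
  · subst h
    exact ⟨_, opF_hv_self hα⟩
  · have h2 : D.B γ α ≠ 2 := fun e => h ((D.pair_two_iff γ (D.base_sub hγ) α hα).1 e)
    rw [opF_hv_of_ne hα hγ h2]
    split_ifs
    · exact ⟨1, (one_smul _ _).symm⟩
    · exact ⟨0, (zero_smul _ _).symm⟩

/-- The three cases in the definition of `F_α x_μ`. -/
lemma pair_cases {α : E} (hα : α ∈ D.Base) {μ : E} (hμ : μ ∈ D.Phi) : D.B μ α ≤ 0 ∨ D.B μ α = 1 ∨ μ = α := by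
  rcases D.pair_range μ hμ α hα with h | h | h | h | h
  · exact Or.inl (by linarith)
  · exact Or.inl (by linarith)
  · exact Or.inl h.le
  · exact Or.inr (Or.inl h)
  · exact Or.inr (Or.inr ((D.pair_two_iff μ hμ α hα).1 h))

variable {β : E} (hβ : β ∈ D.Base)

lemma opF_opF_xv_of_nonpos (h : D.B α β = 0) {μ : E} (hμ : μ ∈ D.Phi) (ha : D.B μ α ≤ 0) :
    D.opF α hα (D.opF β hβ (D.xv μ hμ)) = 0 := by
  have h' : D.B β α = 0 := by rw [D.symm, h]
  rcases pair_cases hβ hμ with hb | hb | rfl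
  · rw [opF_xv_of_nonpos hβ hμ hb, map_zero]
  · rw [opF_xv_of_one hβ hμ hb rfl (D.sub_mem μ hμ β hβ hb), opF_xv_of_nonpos]
    simpa [h'] using ha
  · rw [opF_xv_self hβ, opF_hv_of_ne hα hβ (by rw [h']; norm_num), h']
    norm_num

lemma opF_comm_of_pair_eq_zero (h : D.B α β = 0) :
    D.opF α hα ∘ₗ D.opF β hβ = D.opF β hβ ∘ₗ D.opF α hα := by
  have h' : D.B β α = 0 := by rw [D.symm, h]
  refine D.hom_ext (fun μ hμ => ?_) fun γ hγ => ?_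
  · simp only [LinearMap.comp_apply]
    by_cases ha : D.B μ α ≤ 0
    · rw [opF_opF_xv_of_nonpos hα hβ h hμ ha, opF_xv_of_nonpos hα hμ ha, map_zero]
    by_cases hb : D.B μ β ≤ 0
    · rw [opF_opF_xv_of_nonpos hβ hα h' hμ hb, opF_xv_of_nonpos hβ hμ hb, map_zero]
    obtain ha | rfl := (pair_cases hα hμ).resolve_left ha
    · obtain hb | rfl := (pair_cases hβ hμ).resolve_left hb
      · have hb' : D.B (μ - α) β = 1 := by simp [hb, h]
        have ha' : D.B (μ - β) α = 1 := by simp [ha, h']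
        have hμα := D.sub_mem μ hμ α hα ha
        have hμβ := D.sub_mem μ hμ β hβ hb
        rw [opF_xv_of_one hβ hμ hb rfl hμβ, opF_xv_of_one hα hμ ha rfl hμα,
          opF_xv_of_one hβ hμα hb' rfl (D.sub_mem _ hμα β hβ hb'),
          opF_xv_of_one hα hμβ ha' (sub_right_comm _ _ _)]
      · linarith
    · exact absurd h.le hb
  · obtain ⟨c, hc⟩ := exists_opF_hv_eq_smul hα hγ
    obtain ⟨d, hd⟩ := exists_opF_hv_eq_smul hβ hγ
    simp only [LinearMap.comp_apply, hc, hd, map_smul]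
    rw [opF_xv_of_nonpos hα _ (by simp [h']), opF_xv_of_nonpos hβ _ (by simp [h]), smul_zero,
      smul_zero]

lemma opF_serre_xv (h : D.B α β = -1) {μ : E} (hμ : μ ∈ D.Phi) :
    D.opF α hα (D.opF α hα (D.opF β hβ (D.xv μ hμ)))
      - (qv + qv⁻¹) • D.opF α hα (D.opF β hβ (D.opF α hα (D.xv μ hμ)))
      + D.opF β hβ (D.opF α hα (D.opF α hα (D.xv μ hμ))) = 0 := by
  have h' : D.B β α = -1 := by rw [D.symm, h]
  have hα' := D.base_sub hα
  have hβ' := D.base_sub hβ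
  have hαα := D.norm_two α hα'
  have hββ := D.norm_two β hβ'
  rcases pair_cases hα hμ with ha | ha | rfl
  · rw [opF_xv_of_nonpos hα hμ ha]
    rcases pair_cases hβ hμ with hb | hb | rfl
    · simp [opF_xv_of_nonpos hβ hμ hb]
    · have hμβ := D.sub_mem μ hμ β hβ hb
      rw [opF_xv_of_one hβ hμ hb rfl hμβ]
      by_cases ha' : D.B (μ - β) α ≤ 0
      · simp [opF_xv_of_nonpos hα hμβ ha']
      · obtain ha' | e := (pair_cases hα hμβ).resolve_left ha'
        · rw [opF_xv_of_one hα hμβ ha' rfl (D.sub_mem _ hμβ α hα ha'), opF_xv_of_nonpos]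
          · simp
          · rw [map_sub, LinearMap.sub_apply, ha', hαα]; norm_num
        · have := congrArg (fun x => D.B x α) e
          simp only [map_sub, LinearMap.sub_apply, h', hαα] at this
          linarith
    · rw [opF_xv_self hβ, opF_hv_of_ne hα hβ (by rw [h']; norm_num), if_pos h',
        opF_xv_of_nonpos hα _ (by simp [hαα])]
      simp
  · have hμα := D.sub_mem μ hμ α hα ha
    have ha' : D.B (μ - α) α = -1 := by
      rw [map_sub, LinearMap.sub_apply, ha, hαα]; norm_num
    have hb' : D.B (μ - α) β = D.B μ β + 1 := by simp [h]
    rw [opF_xv_of_one hα hμ ha rfl hμα, opF_xv_of_nonpos hα hμα (by rw [ha']; norm_num)]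
    rcases pair_cases hβ hμ with hb | hb | rfl
    · rw [opF_xv_of_nonpos hβ hμ hb]
      rcases pair_cases hβ hμα with hc | hc | e
      · simp [opF_xv_of_nonpos hβ hμα hc]
      · rw [opF_xv_of_one hβ hμα hc rfl (D.sub_mem _ hμα β hβ hc), opF_xv_of_nonpos]
        · simp
        · rw [map_sub, LinearMap.sub_apply, ha', h']; norm_num
      · rw [e, hββ] at hb'
        linarith
    · have hμβ := D.sub_mem μ hμ β hβ hb
      have e : μ - α = β := (D.pair_two_iff _ hμα β hβ).1 (by rw [hb', hb]; norm_num)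
      have e' : μ - β = α := by rw [← e]; abel
      rw [opF_xv_of_one hβ hμ hb e' hα', opF_xv_self, opF_hv_self]
      have hF : D.opF β hβ (D.xv (μ - α) hμα) = D.hv β hβ := by
        simp only [e, opF_xv_self]
      rw [hF, opF_hv_of_ne hα hβ (by rw [h']; norm_num), if_pos h', map_zero, sub_self, add_zero]
    · linarith
  · rw [opF_xv_of_nonpos hβ hμ (by rw [h]; norm_num), opF_xv_self, opF_hv_self,
      opF_hv_of_ne hβ hα (by rw [h]; norm_num), if_pos h, map_smul]
    have ha : D.B (-β) μ = 1 := by simp [h']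
    have hb : D.B (-μ) β = 1 := by simp [h]
    have hβμ := D.sub_mem _ (D.neg_mem β hβ') μ hα ha
    rw [opF_xv_of_one hα _ ha rfl hβμ, opF_xv_of_one hβ _ hb (by abel) hβμ, map_zero, map_zero,
      zero_sub, neg_add_cancel]

lemma opF_serre_hv (h : D.B α β = -1) {γ : E} (hγ : γ ∈ D.Base) :
    D.opF α hα (D.opF α hα (D.opF β hβ (D.hv γ hγ)))
      - (qv + qv⁻¹) • D.opF α hα (D.opF β hβ (D.opF α hα (D.hv γ hγ)))
      + D.opF β hβ (D.opF α hα (D.opF α hα (D.hv γ hγ))) = 0 := by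
  have h' : D.B β α = -1 := by rw [D.symm, h]
  have hα' := D.base_sub hα
  have hβ' := D.base_sub hβ
  have hαα := D.norm_two α hα'
  have ha : D.B (-β) α = 1 := by simp [h']
  have hb : D.B (-α) β = 1 := by simp [h]
  have hβα := D.sub_mem _ (D.neg_mem β hβ') α hα ha
  obtain ⟨c, hc⟩ := exists_opF_hv_eq_smul hα hγ
  obtain ⟨d, hd⟩ := exists_opF_hv_eq_smul hβ hγ
  have h0 : D.opF α hα (D.xv (-β - α) hβα) = 0 :=
    opF_xv_of_nonpos hα hβα (by rw [map_sub, LinearMap.sub_apply, ha, hαα]; norm_num)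
  simp only [hc, hd, map_smul]
  rw [opF_xv_of_one hα _ ha rfl hβα, opF_xv_of_one hβ _ hb (by abel) hβα, h0,
    opF_xv_of_nonpos hα _ (by simp [hαα])]
  simp

end SimplyLacedDatum

/-- for simple roots `α, β` with `(α,β) = 0` the operators `F_α, F_β`
commute, and for `(α,β) = −1` they satisfy the quantum Serre relation
`F_α² F_β − (q + q⁻¹) F_α F_β F_α + F_β F_α² = 0` on `R`. -/
theorem SimplyLacedDatum.serre_F {E : Type} [AddCommGroup E] [Module ℚ E]
    (D : SimplyLacedDatum E) (α : E) (hα : α ∈ D.Base) (β : E) (hβ : β ∈ D.Base) :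
    (D.B α β = 0 → D.opF α hα ∘ₗ D.opF β hβ = D.opF β hβ ∘ₗ D.opF α hα) ∧
    (D.B α β = -1 →
      D.opF α hα ∘ₗ D.opF α hα ∘ₗ D.opF β hβ
        - (qv + qv⁻¹) • (D.opF α hα ∘ₗ D.opF β hβ ∘ₗ D.opF α hα)
        + D.opF β hβ ∘ₗ D.opF α hα ∘ₗ D.opF α hα = 0) := by
  refine ⟨opF_comm_of_pair_eq_zero hα hβ, fun h => ?_⟩
  refine D.hom_ext (fun μ hμ => opF_serre_xv hα hβ h hμ) fun γ hγ => ?_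
  exact opF_serre_hv hα hβ h hγ
end

section
/- Let k be an algebraically closed field of characteristic 3 and let D be the dihedral group of order 12. Then the group algebra k[D] is isomorphic as a k-algebra to the direct product A_k(Γ₂) × A_k(Γ₂) of two copies of the zigzag algebra of the two-vertex chain over k. -/
noncomputable section

/-- Generators of the zigzag algebra `A(Γ₂)` of the two-vertex chain: the idempotents
`e₁, e₂` and the arrows `u : 1 → 2`, `v : 2 → 1`. -/
inductive ChainGen : Type
  | e1 : ChainGen
  | e2 : ChainGen
  | u : ChainGen
  | v : ChainGen

/-- The defining relations of `A_k(Γ₂)`: `e₁, e₂` are orthogonal idempotents summing to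
`1`, `u = e₂ u e₁`, `v = e₁ v e₂`, and all paths of length greater than two vanish:
`u v u = 0`, `v u v = 0`. -/
inductive ChainRel (k : Type) [CommRing k] :
    FreeAlgebra k ChainGen → FreeAlgebra k ChainGen → Prop
  | e1_idem : ChainRel k (FreeAlgebra.ι k ChainGen.e1 * FreeAlgebra.ι k ChainGen.e1)
      (FreeAlgebra.ι k ChainGen.e1)
  | e2_idem : ChainRel k (FreeAlgebra.ι k ChainGen.e2 * FreeAlgebra.ι k ChainGen.e2)
      (FreeAlgebra.ι k ChainGen.e2)
  | e1e2 : ChainRel k (FreeAlgebra.ι k ChainGen.e1 * FreeAlgebra.ι k ChainGen.e2) 0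
  | e2e1 : ChainRel k (FreeAlgebra.ι k ChainGen.e2 * FreeAlgebra.ι k ChainGen.e1) 0
  | sum_one : ChainRel k (FreeAlgebra.ι k ChainGen.e1 + FreeAlgebra.ι k ChainGen.e2) 1
  | u_id : ChainRel k
      (FreeAlgebra.ι k ChainGen.e2 * FreeAlgebra.ι k ChainGen.u * FreeAlgebra.ι k ChainGen.e1)
      (FreeAlgebra.ι k ChainGen.u)
  | v_id : ChainRel k
      (FreeAlgebra.ι k ChainGen.e1 * FreeAlgebra.ι k ChainGen.v * FreeAlgebra.ι k ChainGen.e2)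
      (FreeAlgebra.ι k ChainGen.v)
  | uvu : ChainRel k
      (FreeAlgebra.ι k ChainGen.u * FreeAlgebra.ι k ChainGen.v * FreeAlgebra.ι k ChainGen.u) 0
  | vuv : ChainRel k
      (FreeAlgebra.ι k ChainGen.v * FreeAlgebra.ι k ChainGen.u * FreeAlgebra.ι k ChainGen.v) 0

/-- The zigzag algebra `A_k(Γ₂)` of the chain with two vertices, over `k`. -/
abbrev ZigzagChainTwo (k : Type) [CommRing k] : Type := RingQuot (ChainRel k)

namespace DihedralGroup

/-- The homomorphism out of a finite dihedral group determined by the images `ρ` of the generating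
rotation and `σ` of a reflection. -/
def liftPow {n : ℕ} [NeZero n] {M : Type*} [Monoid M] (ρ σ : M) (hρ : ρ ^ n = 1)
    (hσ : σ * σ = 1) (h : ρ * σ * ρ = σ) : DihedralGroup n →* M :=
  have hadd (i j : ZMod n) : ρ ^ (i + j).val = ρ ^ i.val * ρ ^ j.val := by
    rw [ZMod.val_add, ← pow_add, ← pow_eq_pow_mod _ hρ]
  have hconj (a : ℕ) : ρ ^ a * σ * ρ ^ a = σ := by
    induction a with
    | zero => simp
    | succ a ih =>
      calc ρ ^ (a + 1) * σ * ρ ^ (a + 1) = ρ ^ a * (ρ * σ * ρ) * ρ ^ a := by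
            conv_lhs => enter [2]; rw [pow_succ']
            simp only [pow_succ, mul_assoc]
        _ = σ := by rw [h, ih]
  have hsub (i j : ZMod n) : ρ ^ i.val * (σ * ρ ^ j.val) = σ * ρ ^ (j - i).val := by
    rw [← add_sub_cancel i j, hadd, ← mul_assoc, ← mul_assoc, hconj, add_sub_cancel]
  { toFun := fun
      | r i => ρ ^ i.val
      | sr i => σ * ρ ^ i.val
    map_one' := by change ρ ^ (0 : ZMod n).val = 1; simp
    map_mul' := by
      rintro (i | i) (j | j)
      · exact hadd i j
      · exact (hsub i j).symm
      · simp only [sr_mul_r, hadd, mul_assoc]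
      · simp only [sr_mul_sr, mul_assoc, hsub]
        rw [← mul_assoc, hσ, one_mul] }

@[simp]
theorem liftPow_r {n : ℕ} [NeZero n] {M : Type*} [Monoid M] (ρ σ : M) (hρ : ρ ^ n = 1)
    (hσ : σ * σ = 1) (h : ρ * σ * ρ = σ) (i : ZMod n) :
    liftPow ρ σ hρ hσ h (r i) = ρ ^ i.val := rfl

@[simp]
theorem liftPow_sr {n : ℕ} [NeZero n] {M : Type*} [Monoid M] (ρ σ : M) (hρ : ρ ^ n = 1)
    (hσ : σ * σ = 1) (h : ρ * σ * ρ = σ) (i : ZMod n) :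
    liftPow ρ σ hρ hσ h (sr i) = σ * ρ ^ i.val := rfl

end DihedralGroup

namespace ZigzagChainTwo

variable (k : Type) [CommRing k]

/-- The image of a generator in the zigzag algebra. -/
def gen (g : ChainGen) : ZigzagChainTwo k :=
  RingQuot.mkAlgHom k (ChainRel k) (FreeAlgebra.ι k g)

open ChainGen

theorem e1_mul_e1 : gen k e1 * gen k e1 = gen k e1 := by
  simpa only [gen, map_mul] using RingQuot.mkAlgHom_rel k (ChainRel.e1_idem (k := k))

theorem e2_mul_e2 : gen k e2 * gen k e2 = gen k e2 := by
  simpa only [gen, map_mul] using RingQuot.mkAlgHom_rel k (ChainRel.e2_idem (k := k))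

theorem e1_mul_e2 : gen k e1 * gen k e2 = 0 := by
  simpa only [gen, map_mul, map_zero] using RingQuot.mkAlgHom_rel k (ChainRel.e1e2 (k := k))

theorem e2_mul_e1 : gen k e2 * gen k e1 = 0 := by
  simpa only [gen, map_mul, map_zero] using RingQuot.mkAlgHom_rel k (ChainRel.e2e1 (k := k))

theorem e1_add_e2 : gen k e1 + gen k e2 = 1 := by
  simpa only [gen, map_add, map_one] using RingQuot.mkAlgHom_rel k (ChainRel.sum_one (k := k))

theorem e2_mul_u_mul_e1 : gen k e2 * gen k u * gen k e1 = gen k u := by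
  simpa only [gen, map_mul] using RingQuot.mkAlgHom_rel k (ChainRel.u_id (k := k))

theorem e1_mul_v_mul_e2 : gen k e1 * gen k v * gen k e2 = gen k v := by
  simpa only [gen, map_mul] using RingQuot.mkAlgHom_rel k (ChainRel.v_id (k := k))

theorem u_mul_v_mul_u : gen k u * gen k v * gen k u = 0 := by
  simpa only [gen, map_mul, map_zero] using RingQuot.mkAlgHom_rel k (ChainRel.uvu (k := k))

theorem v_mul_u_mul_v : gen k v * gen k u * gen k v = 0 := by
  simpa only [gen, map_mul, map_zero] using RingQuot.mkAlgHom_rel k (ChainRel.vuv (k := k))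

theorem e1_mul_u : gen k e1 * gen k u = 0 := by
  rw [← e2_mul_u_mul_e1, ← mul_assoc, ← mul_assoc, e1_mul_e2, zero_mul, zero_mul]

theorem e2_mul_u : gen k e2 * gen k u = gen k u := by
  rw [← e2_mul_u_mul_e1, ← mul_assoc, ← mul_assoc, e2_mul_e2]

theorem u_mul_e2 : gen k u * gen k e2 = 0 := by
  rw [← e2_mul_u_mul_e1, mul_assoc, e1_mul_e2, mul_zero]

theorem u_mul_e1 : gen k u * gen k e1 = gen k u := by
  rw [← e2_mul_u_mul_e1, mul_assoc, e1_mul_e1]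

theorem e2_mul_v : gen k e2 * gen k v = 0 := by
  rw [← e1_mul_v_mul_e2, ← mul_assoc, ← mul_assoc, e2_mul_e1, zero_mul, zero_mul]

theorem e1_mul_v : gen k e1 * gen k v = gen k v := by
  rw [← e1_mul_v_mul_e2, ← mul_assoc, ← mul_assoc, e1_mul_e1]

theorem v_mul_e1 : gen k v * gen k e1 = 0 := by
  rw [← e1_mul_v_mul_e2, mul_assoc, e2_mul_e1, mul_zero]

theorem v_mul_e2 : gen k v * gen k e2 = gen k v := by
  rw [← e1_mul_v_mul_e2, mul_assoc, e2_mul_e2]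

theorem u_mul_u : gen k u * gen k u = 0 := by
  rw [← mul_zero (gen k u), ← e1_mul_u, ← mul_assoc, u_mul_e1]

theorem v_mul_v : gen k v * gen k v = 0 := by
  rw [← mul_zero (gen k v), ← e2_mul_v, ← mul_assoc, v_mul_e2]

/-- The grading involution `e₁ - e₂`. -/
def sgn : ZigzagChainTwo k := gen k e1 - gen k e2

/-- The sum `u + v` of the arrows. -/
def arrow : ZigzagChainTwo k := gen k u + gen k v

theorem sgn_mul_sgn : sgn k * sgn k = 1 := by
  simp only [sgn, sub_mul, mul_sub, e1_mul_e1, e1_mul_e2, e2_mul_e1, e2_mul_e2, ← e1_add_e2 k]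
  abel

theorem sgn_mul_arrow : sgn k * arrow k = -(arrow k * sgn k) := by
  simp only [sgn, arrow, sub_mul, mul_sub, add_mul, mul_add, e1_mul_u, e1_mul_v, e2_mul_u,
    e2_mul_v, u_mul_e1, u_mul_e2, v_mul_e1, v_mul_e2]
  abel

theorem arrow_pow_three : arrow k ^ 3 = 0 := by
  simp only [pow_succ, pow_zero, one_mul, arrow]
  linear_combination (norm := noncomm_ring) u_mul_u k * (gen k u + gen k v) +
    v_mul_v k * (gen k u + gen k v) + u_mul_v_mul_u k + v_mul_u_mul_v k +
    gen k v * u_mul_u k + gen k u * v_mul_v k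

variable {k}

/-- The homomorphism out of the zigzag algebra determined by complementary orthogonal idempotents
`a`, `b` and an element `x` of cube zero interchanging them. -/
def lift {A : Type*} [Ring A] [Algebra k A] (a b x : A) (haa : a * a = a) (hbb : b * b = b)
    (hab : a * b = 0) (hba : b * a = 0) (hsum : a + b = 1) (hax : a * x = x * b)
    (hbx : b * x = x * a) (hx : x ^ 3 = 0) : ZigzagChainTwo k →ₐ[k] A :=
  RingQuot.liftAlgHom k ⟨FreeAlgebra.lift k fun
    | e1 => a
    | e2 => b
    | u => x * a
    | v => x * b, by
    rintro _ _ (_ | _ | _ | _ | _ | _ | _ | _ | _) <;>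
      simp only [map_mul, map_add, map_one, map_zero, FreeAlgebra.lift_ι_apply]
    · exact haa
    · exact hbb
    · exact hab
    · exact hba
    · exact hsum
    · rw [← mul_assoc, hbx, mul_assoc, mul_assoc, haa, haa]
    · rw [← mul_assoc, hax, mul_assoc, mul_assoc, hbb, hbb]
    · linear_combination (norm := noncomm_ring) x * hax * b * x * a + x * x * b * hbx * a +
        x * x * hbx * a * a + hx * a * a * a
    · linear_combination (norm := noncomm_ring) x * hbx * a * x * b + x * x * a * hax * b +
        x * x * hax * b * b + hx * b * b * b⟩

section Lift

variable {A : Type*} [Ring A] [Algebra k A] {a b x : A} (haa : a * a = a) (hbb : b * b = b)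
  (hab : a * b = 0) (hba : b * a = 0) (hsum : a + b = 1) (hax : a * x = x * b)
  (hbx : b * x = x * a) (hx : x ^ 3 = 0)

@[simp]
theorem lift_e1 : lift (k := k) a b x haa hbb hab hba hsum hax hbx hx (gen k e1) = a := by
  simp [lift, gen]

@[simp]
theorem lift_e2 : lift (k := k) a b x haa hbb hab hba hsum hax hbx hx (gen k e2) = b := by
  simp [lift, gen]

@[simp]
theorem lift_u : lift (k := k) a b x haa hbb hab hba hsum hax hbx hx (gen k u) = x * a := by
  simp [lift, gen]

@[simp]
theorem lift_v : lift (k := k) a b x haa hbb hab hba hsum hax hbx hx (gen k v) = x * b := by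
  simp [lift, gen]

theorem lift_sgn : lift (k := k) a b x haa hbb hab hba hsum hax hbx hx (sgn k) = a - b := by
  simp [sgn]

theorem lift_arrow : lift (k := k) a b x haa hbb hab hba hsum hax hbx hx (arrow k) = x := by
  simp [arrow, ← mul_add, hsum]

end Lift

@[ext]
theorem algHom_ext {A : Type*} [Ring A] [Algebra k A] {f g : ZigzagChainTwo k →ₐ[k] A}
    (h : ∀ i, f (gen k i) = g (gen k i)) : f = g := by
  apply RingQuot.ringQuot_ext'
  ext i
  exact h i

end ZigzagChainTwo

section CharThree

variable {A : Type*} [Ring A]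

theorem one_sub_sub_sq_pow_three {x : A} (h3 : (3 : A) = 0) (hx : x ^ 3 = 0) :
    (1 - x - x ^ 2) ^ 3 = 1 := by
  linear_combination (norm := noncomm_ring) hx * (5 - 3 * x ^ 2 - x ^ 3) - h3 * x

theorem one_sub_sub_sq_sq {x : A} (h3 : (3 : A) = 0) (hx : x ^ 3 = 0) :
    (1 - x - x ^ 2) ^ 2 = 1 + x - x ^ 2 := by
  linear_combination (norm := noncomm_ring) hx * (2 + x) - h3 * x

theorem one_sub_sub_sq_conj {s x : A} (h3 : (3 : A) = 0) (hsx : s * x = -(x * s))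
    (hx : x ^ 3 = 0) : (1 - x - x ^ 2) * s * (1 - x - x ^ 2) = s := by
  have hcs : (1 - x - x ^ 2) * s = s * (1 + x - x ^ 2) := by
    linear_combination (norm := noncomm_ring) hsx * x - hsx - x * hsx
  have hc : (1 + x - x ^ 2) * (1 - x - x ^ 2) = 1 := by
    linear_combination (norm := noncomm_ring) hx * x - h3 * x ^ 2
  rw [hcs, mul_assoc, hc, mul_one]

end CharThree

theorem neg_one_sub_one_of_three_eq_zero {A : Type*} [Ring A] (h3 : (3 : A) = 0) :
    (-1 - 1 : A) = 1 := by
  rw [← sub_eq_zero, ← neg_eq_zero, ← h3]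
  norm_num

theorem neg_mul_mul_neg_self {A : Type*} [Ring A] (a b : A) : -a * b * -a = a * b * a := by
  simp

section DihedralRelations

variable {A : Type*} [Ring A] {R s : A}

theorem mul_pow_two_of_dihedral (hR : R ^ 6 = 1) (h : R * s * R = s) : s * R ^ 2 = R ^ 4 * s := by
  linear_combination (norm := noncomm_ring)
    -(hR * s * R ^ 2) + R ^ 4 * (R * h * R + h)

theorem mul_pow_four_of_dihedral (hR : R ^ 6 = 1) (h : R * s * R = s) :
    s * R ^ 4 = R ^ 2 * s := by
  have h2 := mul_pow_two_of_dihedral hR h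
  linear_combination (norm := noncomm_ring) h2 * R ^ 2 + R ^ 4 * h2 + hR * R ^ 2 * s

theorem mul_pow_three_of_dihedral (hR : R ^ 6 = 1) (h : R * s * R = s) :
    s * R ^ 3 = R ^ 3 * s := by
  linear_combination (norm := noncomm_ring)
    -(hR * s * R ^ 3) + R ^ 3 * (R ^ 2 * h * R ^ 2 + R * h * R + h)

theorem mul_sub_of_dihedral (hR : R ^ 6 = 1) (h : R * s * R = s) :
    s * (R ^ 4 - R ^ 2) = -((R ^ 4 - R ^ 2) * s) := by
  rw [mul_sub, mul_pow_two_of_dihedral hR h, mul_pow_four_of_dihedral hR h]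
  noncomm_ring

theorem sub_pow_three_of_pow_six (h3 : (3 : A) = 0) (hR : R ^ 6 = 1) :
    (R ^ 4 - R ^ 2) ^ 3 = 0 := by
  linear_combination (norm := noncomm_ring) hR * R ^ 6 - h3 * (R ^ 10 - R ^ 8)

theorem one_sub_sub_sq_of_pow_six (h3 : (3 : A) = 0) (hR : R ^ 6 = 1) :
    1 - (R ^ 4 - R ^ 2) - (R ^ 4 - R ^ 2) ^ 2 = R ^ 4 := by
  linear_combination (norm := noncomm_ring) hR * (2 - R ^ 2) + h3 * (1 - R ^ 4)

end DihedralRelations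

namespace ZigzagChainTwo

variable {k : Type} [CommRing k]

/-- In characteristic `3`, elements `R`, `s` of an algebra satisfying the relations of the dihedral
group of order `12` determine a homomorphism out of the zigzag algebra. -/
def liftDihedral {A : Type*} [Ring A] [Algebra k A] (h3 : (3 : A) = 0) (R s : A) (hR : R ^ 6 = 1)
    (hs : s * s = 1) (h : R * s * R = s) : ZigzagChainTwo k →ₐ[k] A :=
  have hsx := mul_sub_of_dihedral hR h
  lift (-(1 + s)) (s - 1) (R ^ 4 - R ^ 2)
    (by linear_combination (norm := noncomm_ring) hs + h3 * (1 + s))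
    (by linear_combination (norm := noncomm_ring) hs + h3 * (1 - s))
    (by linear_combination (norm := noncomm_ring) -hs)
    (by linear_combination (norm := noncomm_ring) -hs)
    (Eq.trans (by abel) (neg_one_sub_one_of_three_eq_zero h3))
    (by rw [neg_mul, add_mul, hsx]; noncomm_ring)
    (by rw [sub_mul, hsx]; noncomm_ring)
    (sub_pow_three_of_pow_six h3 hR)

/-- The unipotent element `1 - x - x²` of order `3`, where `x = u + v`. -/
def rot (k : Type) [CommRing k] : ZigzagChainTwo k := 1 - arrow k - arrow k ^ 2

section LiftDihedral

variable {A : Type*} [Ring A] [Algebra k A] (h3 : (3 : A) = 0) {R s : A} (hR : R ^ 6 = 1)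
  (hs : s * s = 1) (h : R * s * R = s)

theorem liftDihedral_sgn : liftDihedral (k := k) h3 R s hR hs h (sgn k) = s := by
  rw [liftDihedral, lift_sgn]
  linear_combination (norm := noncomm_ring) -h3 * s

theorem liftDihedral_rot : liftDihedral (k := k) h3 R s hR hs h (rot k) = R ^ 4 := by
  rw [rot, map_sub, map_sub, map_pow, map_one, liftDihedral, lift_arrow,
    one_sub_sub_sq_of_pow_six h3 hR]

end LiftDihedral

theorem three_eq_zero_of_algebra (k : Type*) [CommRing k] [CharP k 3] (A : Type*) [Ring A]
    [Algebra k A] : (3 : A) = 0 := by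
  have h : (3 : k) = 0 := by exact_mod_cast CharP.cast_eq_zero k 3
  rw [← map_ofNat (algebraMap k A) 3, h, map_zero]

variable [CharP k 3]

theorem rot_pow_three : rot k ^ 3 = 1 :=
  one_sub_sub_sq_pow_three (three_eq_zero_of_algebra k _) (arrow_pow_three k)

theorem rot_sq : rot k ^ 2 = 1 + arrow k - arrow k ^ 2 :=
  one_sub_sub_sq_sq (three_eq_zero_of_algebra k _) (arrow_pow_three k)

theorem rot_mul_sgn_mul_rot : rot k * sgn k * rot k = sgn k :=
  one_sub_sub_sq_conj (three_eq_zero_of_algebra k _) (sgn_mul_arrow k) (arrow_pow_three k)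

theorem rot_pow_six : rot k ^ 6 = 1 := by
  rw [show 6 = 3 * 2 from rfl, pow_mul, rot_pow_three, one_pow]

variable (k) in
/-- The homomorphism sending the generating rotation to `(c, -c)` with `c = 1 - x - x²`, and the
reflection to `(e₁ - e₂, e₁ - e₂)`. -/
def ofDihedral : MonoidAlgebra k (DihedralGroup 6) →ₐ[k] ZigzagChainTwo k × ZigzagChainTwo k :=
  MonoidAlgebra.lift k _ _ <| DihedralGroup.liftPow (rot k, -rot k) (sgn k, sgn k)
    (Prod.ext rot_pow_six ((Even.neg_pow (by decide) _).trans rot_pow_six))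
    (by ext <;> simp [sgn_mul_sgn])
    (Prod.ext rot_mul_sgn_mul_rot <|
      (neg_mul_mul_neg_self (rot k) (sgn k)).trans rot_mul_sgn_mul_rot)

end ZigzagChainTwo

namespace DihedralGroup

open ZigzagChainTwo

variable (k : Type) [CommRing k]

/-- The generating rotation in the group algebra of the dihedral group of order `12`. -/
def rotation : MonoidAlgebra k (DihedralGroup 6) := MonoidAlgebra.of k _ (r 1)

/-- The reflection in the group algebra of the dihedral group of order `12`. -/
def reflection : MonoidAlgebra k (DihedralGroup 6) := MonoidAlgebra.of k _ (sr 0)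

theorem rotation_pow_six : rotation k ^ 6 = 1 := by
  rw [rotation, ← map_pow, r_one_pow_n, map_one]

theorem reflection_mul_reflection : reflection k * reflection k = 1 := by
  rw [reflection, ← map_mul, sr_mul_self, map_one]

theorem rotation_mul_reflection_mul_rotation :
    rotation k * reflection k * rotation k = reflection k := by
  simp only [reflection, rotation, ← map_mul, r_mul_sr, sr_mul_r, sub_add_cancel]

theorem of_r (i : ZMod 6) : MonoidAlgebra.of k _ (r i) = rotation k ^ i.val := by
  rw [rotation, ← map_pow, r_one_pow, ZMod.natCast_zmod_val]

theorem of_sr (i : ZMod 6) :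
    MonoidAlgebra.of k _ (sr i) = reflection k * rotation k ^ i.val := by
  rw [← of_r, reflection, ← map_mul, sr_mul_r, zero_add]

variable {k} [CharP k 3]

theorem ofDihedral_rotation : ofDihedral k (rotation k) = (rot k, -rot k) := by
  rw [ofDihedral, rotation, MonoidAlgebra.lift_of, liftPow_r]
  exact pow_one _

theorem ofDihedral_reflection : ofDihedral k (reflection k) = (sgn k, sgn k) := by
  rw [ofDihedral, reflection, MonoidAlgebra.lift_of, liftPow_sr, ZMod.val_zero, pow_zero, mul_one]

variable (k)

/-- The embedding of the zigzag algebra in the group algebra with image the subalgebra generated by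
the square of the rotation and the reflection. -/
def ofZigzag : ZigzagChainTwo k →ₐ[k] MonoidAlgebra k (DihedralGroup 6) :=
  liftDihedral (three_eq_zero_of_algebra k _) (rotation k) (reflection k) (rotation_pow_six k)
    (reflection_mul_reflection k) (rotation_mul_reflection_mul_rotation k)

/-- The inverse of `ofDihedral`, assembled from `ofZigzag` by means of the central idempotents
`-(1 + R³)` and `R³ - 1`, where `R` is the generating rotation. -/
def ofZigzagProd : ZigzagChainTwo k × ZigzagChainTwo k →ₗ[k] MonoidAlgebra k (DihedralGroup 6) :=
  (LinearMap.mulLeft k (-(1 + rotation k ^ 3)) ∘ₗ (ofZigzag k).toLinearMap).coprod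
    (LinearMap.mulLeft k (rotation k ^ 3 - 1) ∘ₗ (ofZigzag k).toLinearMap)

variable {k}

theorem ofZigzagProd_apply (y : ZigzagChainTwo k × ZigzagChainTwo k) :
    ofZigzagProd k y = -(1 + rotation k ^ 3) * ofZigzag k y.1 +
      (rotation k ^ 3 - 1) * ofZigzag k y.2 := rfl

theorem ofDihedral_ofZigzag (y : ZigzagChainTwo k) : ofDihedral k (ofZigzag k y) = (y, y) := by
  have h3 := three_eq_zero_of_algebra k (ZigzagChainTwo k)
  have hx : rot k ^ 4 - rot k ^ 2 = arrow k := by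
    rw [pow_succ, rot_pow_three, rot_sq, rot]
    linear_combination (norm := noncomm_ring) -h3 * arrow k
  have he1 : -(1 + sgn k) = gen k .e1 := by
    rw [sgn, ← e1_add_e2 k]
    linear_combination (norm := noncomm_ring) -h3 * gen k .e1
  have he2 : sgn k - 1 = gen k .e2 := by
    rw [sgn, ← e1_add_e2 k]
    linear_combination (norm := noncomm_ring) -h3 * gen k .e2
  have hX : ofDihedral k (rotation k ^ 4 - rotation k ^ 2) = (arrow k, arrow k) := by
    rw [map_sub, map_pow, map_pow, ofDihedral_rotation, ← hx]
    have h4 : (-rot k) ^ 4 = rot k ^ 4 := Even.neg_pow (n := 4) (by decide) (rot k)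
    have h2 : (-rot k) ^ 2 = rot k ^ 2 := Even.neg_pow (n := 2) (by decide) (rot k)
    exact Prod.ext rfl (congrArg₂ (· - ·) h4 h2)
  have hE1 : ofDihedral k (-(1 + reflection k)) = (gen k .e1, gen k .e1) := by
    rw [map_neg, map_add, map_one, ofDihedral_reflection, ← he1]
    rfl
  have hE2 : ofDihedral k (reflection k - 1) = (gen k .e2, gen k .e2) := by
    rw [map_sub, map_one, ofDihedral_reflection, ← he2]
    rfl
  have key : (ofDihedral k).comp (ofZigzag k) =
      (AlgHom.id k (ZigzagChainTwo k)).prod (AlgHom.id k (ZigzagChainTwo k)) := by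
    apply ZigzagChainTwo.algHom_ext
    rintro (_ | _ | _ | _)
    · simp only [ofZigzag, liftDihedral, AlgHom.comp_apply, lift_e1]
      exact hE1
    · simp only [ofZigzag, liftDihedral, AlgHom.comp_apply, lift_e2]
      exact hE2
    · simp only [ofZigzag, liftDihedral, AlgHom.comp_apply, lift_u, map_mul (ofDihedral k), hX, hE1]
      simp [arrow, add_mul, u_mul_e1, v_mul_e1]
    · simp only [ofZigzag, liftDihedral, AlgHom.comp_apply, lift_v, map_mul (ofDihedral k), hX, hE2]
      simp [arrow, add_mul, u_mul_e2, v_mul_e2]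
  exact DFunLike.congr_fun key y

theorem ofDihedral_ofZigzagProd (y : ZigzagChainTwo k × ZigzagChainTwo k) :
    ofDihedral k (ofZigzagProd k y) = y := by
  have h3 := three_eq_zero_of_algebra k (ZigzagChainTwo k)
  have hR : ofDihedral k (rotation k ^ 3) = (1, -1) := by
    rw [map_pow, ofDihedral_rotation]
    exact Prod.ext rot_pow_three ((Odd.neg_pow (n := 3) (by decide) _).trans
      (congrArg _ rot_pow_three))
  have hneg := neg_one_sub_one_of_three_eq_zero h3
  rw [ofZigzagProd_apply, map_add, map_mul, map_mul, map_neg, map_add, map_sub, map_one, hR,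
    ofDihedral_ofZigzag, ofDihedral_ofZigzag]
  ext
  · change -(1 + 1) * y.1 + (1 - 1) * y.2 = y.1
    rw [neg_add', hneg, sub_self, zero_mul, one_mul, add_zero]
  · change -(1 + -1) * y.1 + (-1 - 1) * y.2 = y.2
    rw [hneg, add_neg_cancel, neg_zero, zero_mul, one_mul, zero_add]

theorem ofZigzagProd_rotation_mul (b : MonoidAlgebra k (DihedralGroup 6)) :
    ofZigzagProd k (ofDihedral k (rotation k * b)) =
      rotation k * ofZigzagProd k (ofDihedral k b) := by
  have hrot : ofZigzag k (rot k) = rotation k ^ 4 := liftDihedral_rot ..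
  have hR := rotation_pow_six k
  rw [map_mul, ofDihedral_rotation, ofZigzagProd_apply, ofZigzagProd_apply, Prod.fst_mul,
    Prod.snd_mul, map_mul, map_mul, map_neg, hrot]
  generalize ofZigzag k _ = y
  generalize ofZigzag k _ = z
  linear_combination (norm := noncomm_ring) -(hR * rotation k * (y + z))

theorem ofZigzagProd_reflection_mul (b : MonoidAlgebra k (DihedralGroup 6)) :
    ofZigzagProd k (ofDihedral k (reflection k * b)) =
      reflection k * ofZigzagProd k (ofDihedral k b) := by
  have hsgn : ofZigzag k (sgn k) = reflection k := liftDihedral_sgn ..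
  have hR := mul_pow_three_of_dihedral (rotation_pow_six k)
    (rotation_mul_reflection_mul_rotation k)
  rw [map_mul, ofDihedral_reflection, ofZigzagProd_apply, ofZigzagProd_apply, Prod.fst_mul,
    Prod.snd_mul, map_mul, map_mul, hsgn]
  generalize ofZigzag k _ = y
  generalize ofZigzag k _ = z
  linear_combination (norm := noncomm_ring) hR * y - hR * z

theorem ofZigzagProd_one : ofZigzagProd k 1 = 1 := by
  have h3 := three_eq_zero_of_algebra k (MonoidAlgebra k (DihedralGroup 6))
  rw [ofZigzagProd_apply, Prod.fst_one, Prod.snd_one, map_one]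
  exact Eq.trans (by noncomm_ring) (neg_one_sub_one_of_three_eq_zero h3)

theorem ofZigzagProd_rotation_pow (n : ℕ) :
    ofZigzagProd k (ofDihedral k (rotation k ^ n)) = rotation k ^ n := by
  induction n with
  | zero => rw [pow_zero, map_one, ofZigzagProd_one]
  | succ n ih => rw [pow_succ', ofZigzagProd_rotation_mul, ih]

theorem ofZigzagProd_ofDihedral (b : MonoidAlgebra k (DihedralGroup 6)) :
    ofZigzagProd k (ofDihedral k b) = b := by
  induction b using MonoidAlgebra.induction_on with
  | of g =>
    rcases g with i | i
    · rw [of_r, ofZigzagProd_rotation_pow]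
    · rw [of_sr, ofZigzagProd_reflection_mul, ofZigzagProd_rotation_pow]
  | add x y hx hy => rw [map_add, map_add, hx, hy]
  | smul c x hx => rw [map_smul, map_smul, hx]

end DihedralGroup

/-- over an algebraically closed field `k` of characteristic `3`, the
group algebra of the dihedral group of order `12` is isomorphic as a `k`-algebra to the
direct product of two copies of the zigzag algebra `A_k(Γ₂)`. -/
theorem groupAlgebra_dihedral12_iso_zigzag_prod
    (k : Type) [Field k] [IsAlgClosed k] [CharP k 3] :
    Nonempty
      (MonoidAlgebra k (DihedralGroup 6) ≃ₐ[k]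
        (ZigzagChainTwo k × ZigzagChainTwo k)) := by
  exact ⟨{ ZigzagChainTwo.ofDihedral k with
    invFun := DihedralGroup.ofZigzagProd k
    left_inv := DihedralGroup.ofZigzagProd_ofDihedral
    right_inv := DihedralGroup.ofDihedral_ofZigzagProd }⟩

end
end
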